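/- Let t = 2t' be an even positive integer and b a complex number. Then Σ_{λ ∈ DD} δ_λ x^{|λ|/2} ∏_{h ∈ H_t(λ)} bt/(h ε_h) = exp(-b x^{t'} - t b² x^t / 2) · ∏_{k≥1} (1-x^k)(1-x^{kt})^{t'-1}/(1-x^{kt'}), as formal power series in x over ℂ, where the sum ranges over all doubled distinct partitions. -/

import Mathlib

/-!
Statement 14 (Corollary `cor6`): for `t = 2t'` an even positive integer and a
complex number `b`,
Σ_{λ ∈ DD} δ_λ x^{|λ|/2} ∏_{h ∈ H_t(λ)} bt/(h ε_h)
  = exp(-b x^{t'} - t b² x^t / 2) · ∏_{k≥1} (1-x^k)(1-x^{kt})^{t'-1}/(1-x^{kt'}),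
as formal power series over ℂ, the sum ranging over doubled distinct partitions.
-/

noncomputable section

open PowerSeries

/-- Product (pi) topology on formal power series. -/
instance {R : Type*} [TopologicalSpace R] : TopologicalSpace (PowerSeries R) :=
  inferInstanceAs (TopologicalSpace ((Unit →₀ ℕ) → R))

/-- The hook length of the box `c = (i, j)` (0-indexed) of a Young diagram. -/
def hookLen (μ : YoungDiagram) (c : ℕ × ℕ) : ℕ :=
  μ.rowLen c.1 + μ.colLen c.2 - c.1 - c.2 - 1

/-- The Durfee length: the number of diagonal cells. -/
def durfee (μ : YoungDiagram) : ℕ :=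
  (μ.cells.filter fun c => c.1 = c.2).card

/-- `ε` of a box: `-1` if strictly above the principal diagonal, `1` otherwise. -/
def eps (c : ℕ × ℕ) : ℂ := if c.2 < c.1 then (-1 : ℂ) else 1

/-- A Young diagram is doubled distinct if, in Frobenius coordinates,
`a_i = b_i + 1` for every diagonal cell. -/
def DDiagram (μ : YoungDiagram) : Prop :=
  ∀ i : ℕ, (i, i) ∈ μ → μ.rowLen i = μ.colLen i + 1

/-- The formal exponential `exp f = Σ_k f^k / k!` of a power series (with zero
constant coefficient). -/
def pexp (f : PowerSeries ℂ) : PowerSeries ℂ :=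
  ∑' k : ℕ, PowerSeries.C (R := ℂ) ((k.factorial : ℂ))⁻¹ * f ^ k

set_option linter.unusedVariables false

/-- divided difference of a monic polynomial of degree `#s - 1` -/
lemma dd_monic {ι : Type*} [DecidableEq ι] (s : Finset ι) (v : ι → ℂ)
    (hv : Set.InjOn v s) (P : Polynomial ℂ) (hP : P.Monic) (hd : P.natDegree + 1 = s.card) :
    ∑ i ∈ s, P.eval (v i) / ∏ j ∈ s.erase i, (v i - v j) = 1 := by
  rw [← Lagrange.coeff_eq_sum hv]
  · have : s.card - 1 = P.natDegree := by omega
    rw [this]; exact hP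
  · rw [Polynomial.degree_eq_natDegree hP.ne_zero]; exact_mod_cast (by omega)

lemma dd_shift {ι : Type*} [DecidableEq ι] (s : Finset ι) (a : ι) (ha : a ∉ s) (v : ι → ℂ)
    (hv : Set.InjOn v (insert a s : Finset ι)) (f : ι → ℂ) :
    ∑ i ∈ insert a s, ((v i - v a) * f i) / ∏ j ∈ (insert a s).erase i, (v i - v j)
      = ∑ i ∈ s, f i / ∏ j ∈ s.erase i, (v i - v j) := by
  rw [Finset.sum_insert ha]
  simp only [sub_self, zero_mul, zero_div, zero_add]
  refine Finset.sum_congr rfl fun i hi => ?_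
  have hia : i ≠ a := fun h => ha (h ▸ hi)
  have h1 : v i - v a ≠ 0 := sub_ne_zero.2 fun h =>
    hia (hv (by simp [hi]) (by simp) h)
  rw [Finset.erase_insert_of_ne hia.symm, Finset.prod_insert (by simp [ha]), mul_div_mul_left _ _ h1]

def Rp {ι : Type*} (s : Finset ι) (v : ι → ℂ) : Polynomial ℂ :=
  ∏ j ∈ s, (Polynomial.X - Polynomial.C (1 + v j))

lemma Rp_eval {ι : Type*} (s : Finset ι) (v : ι → ℂ) (u : ℂ) :
    (Rp s v).eval u = ∏ j ∈ s, (u - 1 - v j) := by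
  simp [Rp, Polynomial.eval_prod, sub_sub]

lemma Rp_monic {ι : Type*} (s : Finset ι) (v : ι → ℂ) : (Rp s v).Monic :=
  Polynomial.monic_prod_of_monic _ _ fun _ _ => Polynomial.monic_X_sub_C _

lemma Rp_deg {ι : Type*} (s : Finset ι) (v : ι → ℂ) : (Rp s v).natDegree = s.card := by
  rw [Rp, Polynomial.natDegree_prod_of_monic _ _ fun _ _ => Polynomial.monic_X_sub_C _]
  simp only [Polynomial.natDegree_X_sub_C, Finset.sum_const, smul_eq_mul, mul_one]

lemma dd_ab {ι : Type*} [DecidableEq ι] (v : ι → ℂ) (s : Finset ι) (hv : Set.InjOn v s) :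
    (∑ i ∈ s, (∏ j ∈ s, (v i - 1 - v j)) / ∏ j ∈ s.erase i, (v i - v j) = - (s.card : ℂ)) ∧
    (∑ i ∈ s, (v i * ∏ j ∈ s, (v i - 1 - v j)) / ∏ j ∈ s.erase i, (v i - v j)
      = - (∑ i ∈ s, v i) + (s.card.choose 2 : ℂ)) := by
  induction s using Finset.induction_on with
  | empty => simp
  | insert a s ha ih =>
    obtain ⟨iha, ihb⟩ := ih (hv.mono (by simp))
    have h1 := dd_monic (insert a s) v hv (Rp s v) (Rp_monic s v)
      (by rw [Rp_deg, Finset.card_insert_of_notMem ha])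
    simp only [Rp_eval] at h1
    have h2 := dd_shift s a ha v hv (fun i => ∏ j ∈ s, (v i - 1 - v j))
    have h3 := dd_shift s a ha v hv (fun i => v i * ∏ j ∈ s, (v i - 1 - v j))
    rw [iha] at h2
    rw [ihb] at h3
    constructor
    · have : ∀ i ∈ insert a s, (∏ j ∈ insert a s, (v i - 1 - v j)) / ∏ j ∈ (insert a s).erase i, (v i - v j)
        = ((v i - v a) * ∏ j ∈ s, (v i - 1 - v j)) / ∏ j ∈ (insert a s).erase i, (v i - v j)
          - (∏ j ∈ s, (v i - 1 - v j)) / ∏ j ∈ (insert a s).erase i, (v i - v j) := by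
        intro i _
        rw [Finset.prod_insert ha]; ring
      rw [Finset.sum_congr rfl this, Finset.sum_sub_distrib, h1, h2, Finset.card_insert_of_notMem ha]
      push_cast; ring
    · have : ∀ i ∈ insert a s, (v i * ∏ j ∈ insert a s, (v i - 1 - v j)) / ∏ j ∈ (insert a s).erase i, (v i - v j)
        = ((v i - v a) * (v i * ∏ j ∈ s, (v i - 1 - v j))) / ∏ j ∈ (insert a s).erase i, (v i - v j)
          - ((v i - v a) * ∏ j ∈ s, (v i - 1 - v j)) / ∏ j ∈ (insert a s).erase i, (v i - v j)
          - v a * ((∏ j ∈ s, (v i - 1 - v j)) / ∏ j ∈ (insert a s).erase i, (v i - v j)) := by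
        intro i _
        rw [Finset.prod_insert ha]; ring
      rw [Finset.sum_congr rfl this, Finset.sum_sub_distrib, Finset.sum_sub_distrib, ← Finset.mul_sum,
        h1, h2, h3, Finset.card_insert_of_notMem ha, Finset.sum_insert ha, Nat.choose_succ_succ' s.card 1]
      push_cast
      simp
      ring

/-- Down identity -/
lemma lag_down {ι : Type*} [DecidableEq ι] (v : ι → ℂ) (s : Finset ι) (hv : Set.InjOn v s) :
    ∑ i ∈ s, v i * ∏ j ∈ s.erase i, ((v i - 1 - v j) / (v i - v j))
      = (∑ i ∈ s, v i) - (s.card.choose 2 : ℂ) := by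
  have h := (dd_ab v s hv).2
  have : ∀ i ∈ s, v i * ∏ j ∈ s.erase i, ((v i - 1 - v j) / (v i - v j)) =
      - ((v i * ∏ j ∈ s, (v i - 1 - v j)) / ∏ j ∈ s.erase i, (v i - v j)) := by
    intro i hi
    rw [Finset.prod_div_distrib, ← Finset.mul_prod_erase s _ hi]
    ring
  rw [Finset.sum_congr rfl this, Finset.sum_neg_distrib, h]; ring

/-- Up identity -/
lemma lag_up {ι : Type*} [DecidableEq ι] (v : ι → ℂ) (s : Finset ι) (hv : Set.InjOn v s)
    (i0 : ι) (hi0 : i0 ∈ s) (h0 : v i0 = 0) (hne : ∀ i ∈ s, v i + 1 ≠ 0) :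
    ∑ i ∈ s, (v i + 1)⁻¹ * ∏ j ∈ s.erase i, ((v i + 1 - v j) / (v i - v j)) = 1 := by
  have h1 := dd_monic s v hv (∏ j ∈ s.erase i0, (Polynomial.X - Polynomial.C (v j - 1)))
    (Polynomial.monic_prod_of_monic _ _ fun _ _ => Polynomial.monic_X_sub_C _)
    (by
      rw [Polynomial.natDegree_prod_of_monic _ _ fun _ _ => Polynomial.monic_X_sub_C _]
      simp only [Polynomial.natDegree_X_sub_C, Finset.sum_const, smul_eq_mul, mul_one,
        Finset.card_erase_of_mem hi0]
      have := Finset.card_pos.2 ⟨i0, hi0⟩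
      omega)
  refine Eq.trans ?_ h1
  refine Finset.sum_congr rfl fun i hi => ?_
  rw [Finset.prod_div_distrib, ← mul_div_assoc]
  congr 1
  have e : ∏ j ∈ s, (v i + 1 - v j) = ∏ j ∈ s.erase i, (v i + 1 - v j) := by
    rw [← Finset.mul_prod_erase s _ hi]; ring
  have e2 : ∏ j ∈ s, (v i + 1 - v j) = (v i + 1) * ∏ j ∈ s.erase i0, (v i + 1 - v j) := by
    rw [← Finset.mul_prod_erase s _ hi0, h0]; ring
  rw [← e, e2, inv_mul_cancel_left₀ (hne i hi), Polynomial.eval_prod]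
  refine Finset.prod_congr rfl fun j _ => ?_
  simp; ring

open scoped Classical in
/-- Bead configurations -/
def Maya (M : ℤ) (S : Set ℤ) : Prop := (∀ n, n < -M → n ∈ S) ∧ (∀ n, M ≤ n → n ∉ S)

def hooks (t : ℕ) (S : Set ℤ) : Set (ℤ × ℤ) :=
  {p | p.1 ∈ S ∧ p.2 ∉ S ∧ p.2 < p.1 ∧ p.1 % t = p.2 % t}

def Gh (t : ℕ) (S : Set ℤ) : ℂ := ∏ᶠ p ∈ hooks t S, ((t : ℂ) / ((p.1 : ℂ) - p.2))

lemma Maya.mono {M N : ℤ} {S : Set ℤ} (h : Maya M S) (hMN : M ≤ N) : Maya N S :=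
  ⟨fun n hn => h.1 n (by omega), fun n hn => h.2 n (by omega)⟩

/-- quotient height -/
def ht (t : ℕ) (B y : ℤ) : ℕ := ((y - B) / t).toNat

lemma ht_cast (t : ℕ) (htp : 0 < t) (B y : ℤ) (hy : B ≤ y) : (ht t B y : ℤ) = (y - B) / t := by
  rw [ht, Int.toNat_of_nonneg]
  exact Int.ediv_nonneg (by omega) (by omega)

lemma ht_sub (t : ℕ) (htp : 0 < t) (B y z : ℤ) (hy : B ≤ y) (hz : B ≤ z) (h : y % t = z % t) :
    (t : ℤ) * ((ht t B y : ℤ) - ht t B z) = y - z := by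
  rw [ht_cast t htp B y hy, ht_cast t htp B z hz]
  have h1 := Int.mul_ediv_add_emod (y - B) t
  have h2 := Int.mul_ediv_add_emod (z - B) t
  have h3 : (y - B) % t = (z - B) % t := Int.ModEq.sub_right B h
  rw [mul_sub]; omega

lemma ht_sub' (t : ℕ) (htp : 0 < t) (B y z : ℤ) (hy : B ≤ y) (hz : B ≤ z) (h : y % t = z % t) :
    ((y : ℂ) - z) / t = (ht t B y : ℂ) - ht t B z := by
  have h1 := ht_sub t htp B y z hy hz h
  have h2 : (t : ℂ) * ((ht t B y : ℂ) - ht t B z) = y - z := by exact_mod_cast h1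
  have : (t : ℂ) ≠ 0 := by exact_mod_cast htp.ne'
  field_simp
  rw [← h2]

lemma ht_lt (t : ℕ) (htp : 0 < t) (B y z : ℤ) (hy : B ≤ y) (hz : B ≤ z) (h : y % t = z % t) :
    z < y ↔ ht t B z < ht t B y := by
  have h1 := ht_sub t htp B y z hy hz h
  have ht0 : (0 : ℤ) < t := by exact_mod_cast htp
  constructor
  · intro h2
    by_contra h3
    have : (ht t B y : ℤ) - ht t B z ≤ 0 := by omega
    nlinarith
  · intro h2
    have : 1 ≤ (ht t B y : ℤ) - ht t B z := by omega
    nlinarith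

/-- the column of elements below `y` in its class -/
def below (t : ℕ) (B y : ℤ) : Finset ℤ := (Finset.Ico B y).filter (fun z => y % t = z % t)

lemma mem_below {t : ℕ} {B y z : ℤ} : z ∈ below t B y ↔ (B ≤ z ∧ z < y) ∧ y % t = z % t := by
  simp [below]

lemma ht_add (t : ℕ) (htp : 0 < t) (B y : ℤ) (hy : B ≤ y) : ht t B (y + t) = ht t B y + 1 := by
  have h := ht_sub t htp B (y + t) y (by omega) hy (by simp)
  have ht0 : (0 : ℤ) < t := by exact_mod_cast htp
  have : (ht t B (y + t) : ℤ) - ht t B y = 1 := by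
    have h2 : (t : ℤ) * ((ht t B (y + t) : ℤ) - ht t B y) = t * 1 := by rw [h]; ring
    exact mul_left_cancel₀ ht0.ne' h2
  omega

lemma below_image (t : ℕ) (htp : 0 < t) (B y : ℤ) (hy : B ≤ y) :
    (below t B y).image (ht t B) = Finset.range (ht t B y) := by
  ext k
  simp only [Finset.mem_image, mem_below, Finset.mem_range]
  have ht0 : (0 : ℤ) < t := by exact_mod_cast htp
  constructor
  · rintro ⟨z, ⟨⟨h1, h2⟩, h3⟩, rfl⟩
    exact (ht_lt t htp B y z hy h1 h3).1 h2
  · intro hk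
    have e1 := Int.mul_ediv_add_emod (y - B) t
    have e2 := Int.emod_nonneg (y - B) ht0.ne'
    have hc := ht_cast t htp B y hy
    rw [← hc] at e1
    have hk' : (1 : ℤ) ≤ (ht t B y : ℤ) - k := by omega
    have hz : B ≤ y - t * ((ht t B y : ℤ) - k) := by nlinarith
    have hm : y % t = (y - t * ((ht t B y : ℤ) - k)) % t := by simp
    refine ⟨y - t * ((ht t B y : ℤ) - k), ⟨⟨hz, by nlinarith⟩, hm⟩, ?_⟩
    have h4 := ht_sub t htp B y _ hy hz hm
    have : (ht t B y : ℤ) - ht t B (y - t * ((ht t B y : ℤ) - k)) = (ht t B y : ℤ) - k := by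
      refine mul_left_cancel₀ ht0.ne' (h4.trans (by ring))
    omega

lemma below_inj (t : ℕ) (htp : 0 < t) (B y : ℤ) : Set.InjOn (ht t B) (below t B y) := by
  intro a ha b hb h
  simp only [Finset.mem_coe, mem_below] at ha hb
  have := ht_sub t htp B a b ha.1.1 hb.1.1 (by rw [← ha.2, hb.2])
  rw [h] at this
  simp at this
  omega

lemma prod_below (t : ℕ) (htp : 0 < t) (B y : ℤ) (hy : B ≤ y) :
    ∏ z ∈ below t B y, ((ht t B y : ℂ) - ht t B z) = ((ht t B y).factorial : ℂ) := by
  have h := Finset.prod_image (s := below t B y) (g := ht t B)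
    (f := fun k : ℕ => ((ht t B y : ℂ) - k)) (below_inj t htp B y)
  rw [← h, below_image t htp B y hy, ← Finset.prod_range_reflect,
    ← Finset.prod_range_add_one_eq_factorial]
  push_cast
  refine Finset.prod_congr rfl fun k hk => ?_
  have := Finset.mem_range.1 hk
  have e : ht t B y - 1 - k + (k + 1) = ht t B y := by omega
  have e2 : ((ht t B y - 1 - k : ℕ) : ℂ) + (k + 1) = ht t B y := by exact_mod_cast e
  rw [← e2]; ring

lemma card_below (t : ℕ) (htp : 0 < t) (B y : ℤ) (hy : B ≤ y) :
    (below t B y).card = ht t B y := by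
  rw [← Finset.card_image_of_injOn (below_inj t htp B y), below_image t htp B y hy, Finset.card_range]

def Gam (t : ℕ) (B : ℤ) (L : Finset ℤ) : ℂ :=
  ∏ y ∈ L, ((∏ j ∈ L.filter (fun j => j < y ∧ y % t = j % t), ((ht t B y : ℂ) - ht t B j)) /
    ((ht t B y).factorial : ℂ))

open scoped Classical in
def trun (B M : ℤ) (S : Set ℤ) : Finset ℤ := (Finset.Ico B M).filter (fun y => y ∈ S)

lemma mem_trun {B M : ℤ} {S : Set ℤ} {y : ℤ} : y ∈ trun B M S ↔ (B ≤ y ∧ y < M) ∧ y ∈ S := by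
  simp [trun]

lemma mem_trun' {B M : ℤ} {S : Set ℤ} (hS : Maya M S) {y : ℤ} :
    y ∈ trun B M S ↔ B ≤ y ∧ y ∈ S := by
  rw [mem_trun]
  constructor
  · rintro ⟨⟨h1, h2⟩, h3⟩; exact ⟨h1, h3⟩
  · rintro ⟨h1, h3⟩
    exact ⟨⟨h1, by by_contra h; exact hS.2 y (by omega) h3⟩, h3⟩

open scoped Classical in
lemma hooks_eq (t : ℕ) {B M : ℤ} {S : Set ℤ} (hS : Maya M S) (hB : B ≤ -M) :
    hooks t S = ↑((trun B M S).biUnion fun y =>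
      ((below t B y).filter (fun z => z ∉ S)).image (fun z => (y, z))) := by
  ext ⟨y, z⟩
  simp only [hooks, Set.mem_ofPred_eq, Finset.coe_biUnion, Set.mem_iUnion, Finset.mem_coe,
    Finset.mem_image, Finset.mem_filter, mem_below, mem_trun' hS, Prod.mk.injEq]
  constructor
  · rintro ⟨h1, h2, h3, h4⟩
    have : B ≤ z := by
      by_contra h; exact h2 (hS.1 z (by omega))
    exact ⟨y, ⟨by omega, h1⟩, z, ⟨⟨⟨this, h3⟩, h4⟩, h2⟩, rfl, rfl⟩
  · rintro ⟨y', ⟨h1, h2⟩, z', ⟨⟨⟨h3, h4⟩, h5⟩, h6⟩, rfl, rfl⟩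
    exact ⟨h2, h6, h4, h5⟩

lemma hooks_finite (t : ℕ) {M : ℤ} {S : Set ℤ} (hS : Maya M S) : (hooks t S).Finite := by
  rw [hooks_eq t hS (le_refl (-M))]
  exact Finset.finite_toSet _

open scoped Classical in
lemma hooks_disj (t : ℕ) (B M : ℤ) (S : Set ℤ) :
    ((trun B M S : Finset ℤ) : Set ℤ).PairwiseDisjoint (fun y =>
      ((below t B y).filter (fun z => z ∉ S)).image (fun z => (y, z))) := by
  intro a _ b _ hab
  rw [Function.onFun, Finset.disjoint_left]
  intro p hp hq
  simp only [Finset.mem_image] at hp hq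
  obtain ⟨_, _, rfl⟩ := hp
  obtain ⟨_, _, h⟩ := hq
  simp at h
  exact hab h.1.symm

open scoped Classical in
lemma below_filter (t : ℕ) {B M : ℤ} {S : Set ℤ} (hS : Maya M S) (y : ℤ) :
    (below t B y).filter (fun z => z ∈ S) =
      (trun B M S).filter (fun j => j < y ∧ y % t = j % t) := by
  ext z
  simp only [Finset.mem_filter, mem_below, mem_trun' hS]
  tauto

lemma Gh_eq (t : ℕ) (htp : 0 < t) {B M : ℤ} {S : Set ℤ} (hS : Maya M S) (hB : B ≤ -M) :
    Gh t S = Gam t B (trun B M S) := by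
  classical
  rw [Gh, hooks_eq t hS hB, finprod_mem_coe_finset, Finset.prod_biUnion (hooks_disj t B M S), Gam]
  refine Finset.prod_congr rfl fun y hy => ?_
  rw [mem_trun' hS] at hy
  rw [Finset.prod_image (by intro a _ b _ h; simpa using h)]
  rw [← prod_below t htp B y hy.1, ← below_filter t hS y,
    ← Finset.prod_filter_mul_prod_filter_not (below t B y) (fun z => z ∈ S)]
  have hne : ∀ z ∈ below t B y, ((ht t B y : ℂ) - ht t B z) ≠ 0 := by
    intro z hz
    rw [mem_below] at hz
    have := (ht_lt t htp B y z hy.1 hz.1.1 hz.2).1 hz.1.2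
    rw [sub_ne_zero]
    exact_mod_cast this.ne'
  have h1 : ∏ z ∈ (below t B y).filter (fun z => z ∈ S), ((ht t B y : ℂ) - ht t B z) ≠ 0 :=
    Finset.prod_ne_zero_iff.2 fun z hz => hne z (Finset.mem_filter.1 hz).1
  rw [← div_div, div_self h1, one_div, ← Finset.prod_inv_distrib]
  refine Finset.prod_congr rfl fun z hz => ?_
  have hz' := mem_below.1 (Finset.mem_filter.1 hz).1
  rw [← ht_sub' t htp B y z hy.1 hz'.1.1 hz'.2, inv_div]

open scoped Classical in
lemma hooks_ncard (t : ℕ) (htp : 0 < t) {B M : ℤ} {S : Set ℤ} (hS : Maya M S) (hB : B ≤ -M) :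
    ((hooks t S).ncard : ℤ) = ∑ y ∈ trun B M S, ((ht t B y : ℤ) -
      ((trun B M S).filter (fun j => j < y ∧ y % t = j % t)).card) := by
  rw [hooks_eq t hS hB, Set.ncard_coe_finset, Finset.card_biUnion (hooks_disj t B M S)]
  push_cast
  refine Finset.sum_congr rfl fun y hy => ?_
  rw [mem_trun' hS] at hy
  rw [Finset.card_image_of_injective _ (by intro a b h; simpa using h),
    ← card_below t htp B y hy.1, ← below_filter t hS y,
    ← Finset.card_filter_add_card_filter_not (s := below t B y) (fun z => z ∈ S)]
  push_cast
  ring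

lemma gam_insert (t : ℕ) (htp : 0 < t) (B : ℤ) (K : Finset ℤ) (a : ℤ) (ha : a ∉ K)
    (hKB : ∀ y ∈ K, B ≤ y) (hab : B ≤ a) :
    Gam t B (insert a K) = Gam t B K *
      ((∏ j ∈ K.filter (fun j => a % t = j % t), ((|(ht t B a : ℤ) - ht t B j| : ℤ) : ℂ)) /
        ((ht t B a).factorial : ℂ)) := by
  rw [Gam, Gam, Finset.prod_insert ha]
  have e1 : (insert a K).filter (fun j => j < a ∧ a % t = j % t) =
      (K.filter (fun j => a % t = j % t)).filter (fun j => j < a) := by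
    ext j
    simp only [Finset.mem_filter, Finset.mem_insert]
    constructor
    · rintro ⟨rfl | h, h2, h3⟩
      · omega
      · exact ⟨⟨h, h3⟩, h2⟩
    · rintro ⟨⟨h, h3⟩, h2⟩; exact ⟨Or.inr h, h2, h3⟩
  have e2 : ∀ y ∈ K, (∏ j ∈ (insert a K).filter (fun j => j < y ∧ y % t = j % t),
        ((ht t B y : ℂ) - ht t B j)) / ((ht t B y).factorial : ℂ) =
      ((∏ j ∈ K.filter (fun j => j < y ∧ y % t = j % t),
        ((ht t B y : ℂ) - ht t B j)) / ((ht t B y).factorial : ℂ)) *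
        (if a < y ∧ y % t = a % t then ((ht t B y : ℂ) - ht t B a) else 1) := by
    intro y hy
    rw [Finset.filter_insert]
    split_ifs with h
    · rw [Finset.prod_insert (by simp [ha])]; ring
    · ring
  rw [Finset.prod_congr rfl e2, Finset.prod_mul_distrib, e1]
  have e3 : ∏ y ∈ K, (if a < y ∧ y % t = a % t then ((ht t B y : ℂ) - ht t B a) else 1) =
      ∏ y ∈ (K.filter (fun j => a % t = j % t)).filter (fun j => ¬ j < a),
        ((ht t B y : ℂ) - ht t B a) := by
    rw [← Finset.prod_filter]
    refine Finset.prod_congr ?_ fun _ _ => rfl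
    ext j
    simp only [Finset.mem_filter, not_lt]
    constructor
    · rintro ⟨h1, h2, h3⟩; exact ⟨⟨h1, h3.symm⟩, h2.le⟩
    · rintro ⟨⟨h1, h3⟩, h2⟩
      have : a ≠ j := fun h => ha (h ▸ h1)
      exact ⟨h1, by omega, h3.symm⟩
  rw [e3, ← Finset.prod_filter_mul_prod_filter_not (K.filter (fun j => a % t = j % t)) (fun j => j < a)]
  have e4 : ∏ j ∈ (K.filter (fun j => a % t = j % t)).filter (fun j => j < a),
      ((|(ht t B a : ℤ) - ht t B j| : ℤ) : ℂ) = 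
      ∏ j ∈ (K.filter (fun j => a % t = j % t)).filter (fun j => j < a),
        ((ht t B a : ℂ) - ht t B j) := by
    refine Finset.prod_congr rfl fun j hj => ?_
    simp only [Finset.mem_filter] at hj
    have := (ht_lt t htp B a j hab (hKB j hj.1.1) hj.1.2).1 hj.2
    rw [abs_of_nonneg (by omega)]; push_cast; rfl
  have e5 : ∏ j ∈ (K.filter (fun j => a % t = j % t)).filter (fun j => ¬ j < a),
      ((|(ht t B a : ℤ) - ht t B j| : ℤ) : ℂ) = 
      ∏ j ∈ (K.filter (fun j => a % t = j % t)).filter (fun j => ¬ j < a),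
        ((ht t B j : ℂ) - ht t B a) := by
    refine Finset.prod_congr rfl fun j hj => ?_
    simp only [Finset.mem_filter] at hj
    have := (ht_lt t htp B a j hab (hKB j hj.1.1) hj.1.2).not.1 hj.2
    rw [abs_of_nonpos (by omega)]; push_cast; ring
  rw [e4, e5]
  ring

lemma absratio (x y : ℤ) (h : x ≠ 0) (h2 : y ≠ 0) (hxy : |x - y| = 1) :
    ((|x| : ℤ) : ℂ) = ((|y| : ℤ) : ℂ) * ((x : ℂ) / y) := by
  have hy : (y : ℂ) ≠ 0 := by exact_mod_cast h2
  have : |x| * y = |y| * x := by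
    rcases lt_or_gt_of_ne h with h | h <;> rcases lt_or_gt_of_ne h2 with h2 | h2 
    · rw [abs_of_neg h, abs_of_neg h2]; ring
    · rw [abs_of_neg (by omega)] at hxy; omega
    · rw [abs_of_pos (by omega)] at hxy; omega
    · rw [abs_of_pos h, abs_of_pos h2]; ring
  rw [← mul_div_assoc, eq_div_iff hy]
  exact_mod_cast this

/-- two positions `a`, `a + t` both free: compare. -/
lemma gam_move (t : ℕ) (htp : 0 < t) (B : ℤ) (K : Finset ℤ) (a : ℤ) (ha : a ∉ K) (ha' : a + t ∉ K)
    (hKB : ∀ y ∈ K, B ≤ y) (hab : B ≤ a) :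
    Gam t B (insert a K) = Gam t B (insert (a + t) K) * ((ht t B (a + t) : ℂ) *
      ∏ j ∈ K.filter (fun j => (a + t) % t = j % t), (((ht t B (a + t) : ℂ) - 1 - ht t B j) /
        ((ht t B (a + t) : ℂ) - ht t B j))) ∧
    Gam t B (insert (a + t) K) = Gam t B (insert a K) * (((ht t B a : ℂ) + 1)⁻¹ *
      ∏ j ∈ K.filter (fun j => a % t = j % t), (((ht t B a : ℂ) + 1 - ht t B j) /
        ((ht t B a : ℂ) - ht t B j))) := by
  have hmod : (a + t) % t = a % t := by simp
  have hne : ∀ b, b ∉ K → B ≤ b → ∀ j ∈ K.filter (fun j => b % t = j % t), (ht t B b : ℤ) - ht t B j ≠ 0 := by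
    intro b hb hbB j hj h
    rw [Finset.mem_filter] at hj
    have := ht_sub t htp B b j hbB (hKB j hj.1) hj.2
    rw [h] at this
    have : b = j := by omega
    exact hb (this ▸ hj.1)
  have n1 := hne a ha hab
  have n2 := hne (a + t) ha' (by omega)
  have hf : (((ht t B a).factorial : ℕ) : ℂ) ≠ 0 := by exact_mod_cast (Nat.factorial_ne_zero _)
  have hf2 : ((ht t B a : ℂ) + 1) ≠ 0 := by exact Nat.cast_add_one_ne_zero _
  rw [gam_insert t htp B K a ha hKB hab, gam_insert t htp B K (a + t) ha' hKB (by omega)]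
  rw [hmod] at n2 ⊢
  rw [ht_add t htp B a hab] at n2 ⊢
  have q1 : ∏ j ∈ K.filter (fun j => a % t = j % t), ((|(ht t B a : ℤ) - ht t B j| : ℤ) : ℂ) =
      (∏ j ∈ K.filter (fun j => a % t = j % t), ((|((ht t B a + 1 : ℕ) : ℤ) - ht t B j| : ℤ) : ℂ)) * 
      ∏ j ∈ K.filter (fun j => a % t = j % t), ((((ht t B a + 1 : ℕ) : ℂ) - 1 - ht t B j) /
        (((ht t B a + 1 : ℕ) : ℂ) - ht t B j)) := by
    rw [← Finset.prod_mul_distrib]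
    refine Finset.prod_congr rfl fun j hj => ?_
    rw [absratio _ _ (n1 j hj) (n2 j hj) (by push_cast; ring_nf; simp)]
    push_cast; ring_nf
  have q2 : ∏ j ∈ K.filter (fun j => a % t = j % t), ((|((ht t B a + 1 : ℕ) : ℤ) - ht t B j| : ℤ) : ℂ) =
      (∏ j ∈ K.filter (fun j => a % t = j % t), ((|(ht t B a : ℤ) - ht t B j| : ℤ) : ℂ)) * 
      ∏ j ∈ K.filter (fun j => a % t = j % t), (((ht t B a : ℂ) + 1 - ht t B j) /
        ((ht t B a : ℂ) - ht t B j)) := by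
    rw [← Finset.prod_mul_distrib]
    refine Finset.prod_congr rfl fun j hj => ?_
    rw [absratio _ _ (n2 j hj) (n1 j hj) (by push_cast; ring_nf; simp)]
    push_cast; ring_nf
  have hfs : (((ht t B a + 1).factorial : ℕ) : ℂ) = ((ht t B a : ℂ) + 1) * ((ht t B a).factorial : ℂ) := by
    rw [Nat.factorial_succ]; push_cast; ring
  constructor
  · rw [q1, hfs]
    push_cast
    field_simp
  · rw [q2, hfs]
    field_simp

def mv (S : Set ℤ) (a b : ℤ) : Set ℤ := {n | n = b ∨ (n ∈ S ∧ n ≠ a)}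

lemma mem_mv {S : Set ℤ} {a b n : ℤ} : n ∈ mv S a b ↔ n = b ∨ (n ∈ S ∧ n ≠ a) := Iff.rfl

lemma choose_two_pairs (C : Finset ℤ) :
    ∑ y ∈ C, (C.filter (fun j => j < y)).card = C.card.choose 2 := by
  induction C using Finset.induction_on_max with
  | empty => simp
  | insert a s hs ih =>
    have ha : a ∉ s := fun h => lt_irrefl _ (hs a h)
    rw [Finset.sum_insert ha, Finset.card_insert_of_notMem ha, Nat.choose_succ_succ' s.card 1, ← ih]
    congr 1
    · rw [Finset.filter_insert, if_neg (lt_irrefl a), Finset.filter_true_of_mem hs]; simp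
    · refine Finset.sum_congr rfl fun y hy => ?_
      rw [Finset.filter_insert, if_neg (not_lt.2 (hs y hy).le)]

lemma trun_inj (t : ℕ) (htp : 0 < t) (B : ℤ) (L : Finset ℤ) (hL : ∀ y ∈ L, B ≤ y) (ρ : ℤ) :
    Set.InjOn (fun y => (ht t B y : ℂ)) (L.filter (fun y => y % t = ρ)) := by
  intro a ha b hb h
  simp only [Finset.coe_filter, Set.mem_ofPred_eq] at ha hb
  have h1 : ht t B a = ht t B b := by exact_mod_cast (show (ht t B a : ℂ) = ht t B b from h)
  have := ht_sub t htp B a b (hL a ha.1) (hL b hb.1) (by rw [ha.2, hb.2])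
  rw [h1] at this
  simp at this
  omega

lemma cls_erase (t : ℕ) (L : Finset ℤ) (y ρ : ℤ) (hy : y % t = ρ) :
    (L.erase y).filter (fun j => y % t = j % t) = (L.filter (fun j => j % t = ρ)).erase y := by
  ext j
  simp only [Finset.mem_filter, Finset.mem_erase, hy]
  tauto

lemma sum_classes (t : ℕ) (htp : 0 < t) (L : Finset ℤ) (f : ℤ → ℂ) :
    ∑ y ∈ L, f y = ∑ ρ ∈ Finset.Ico (0:ℤ) t, ∑ y ∈ L.filter (fun y => y % t = ρ), f y := by
  rw [Finset.sum_fiberwise_of_maps_to]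
  intro y _
  have ht0 : (0 : ℤ) < t := by exact_mod_cast htp
  exact Finset.mem_Ico.2 ⟨Int.emod_nonneg _ ht0.ne', Int.emod_lt_of_pos _ ht0⟩

lemma down_move (t : ℕ) (htp : 0 < t) (B N : ℤ) (S : Set ℤ) (hS : Maya N S)
    (hB : B + t ≤ - N) (y : ℤ) (hyN : y - t < N) (hy : y ∈ S) (hy' : y - t ∉ S) :
    Gh t (mv S y (y - t)) = Gh t S * ((ht t B y : ℂ) *
      ∏ j ∈ ((trun B N S).erase y).filter (fun j => y % t = j % t),
        (((ht t B y : ℂ) - 1 - ht t B j) / ((ht t B y : ℂ) - ht t B j))) := by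
  have hy1 : -N ≤ y - t := by
    by_contra h
    exact hy' (hS.1 _ (by omega))
  have hM : Maya N (mv S y (y - t)) := by
    constructor
    · intro n hn
      exact Or.inr ⟨hS.1 n hn, by omega⟩
    · rintro n hn (h | ⟨h, _⟩)
      · omega
      · exact hS.2 n hn h
  rw [Gh_eq t htp hM (B := B) (by omega), Gh_eq t htp hS (B := B) (by omega)]
  have e1 : trun B N (mv S y (y - t)) = insert (y - t) ((trun B N S).erase y) := by
    ext n
    simp only [mem_trun' hM, Finset.mem_insert, Finset.mem_erase, mem_trun' hS, mem_mv]
    constructor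
    · rintro ⟨h1, h | h⟩
      · exact Or.inl h
      · exact Or.inr ⟨h.2, h1, h.1⟩
    · rintro (h | h)
      · exact ⟨by omega, Or.inl h⟩
      · exact ⟨h.2.1, Or.inr ⟨h.2.2, h.1⟩⟩
  have e2 : trun B N S = insert ((y - t) + t) ((trun B N S).erase y) := by
    rw [sub_add_cancel, Finset.insert_erase ((mem_trun' hS).2 ⟨by omega, hy⟩)]
  have h := (gam_move t htp B ((trun B N S).erase y) (y - t)
    (by simp only [Finset.mem_erase, mem_trun' hS]; tauto)
    (by simp) (by
      intro j hj
      simp only [Finset.mem_erase, mem_trun' hS] at hj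
      exact hj.2.1) (by omega)).1
  rw [e1, h, ← e2, sub_add_cancel]

lemma up_move (t : ℕ) (htp : 0 < t) (B N : ℤ) (S : Set ℤ) (hS : Maya N S)
    (hB : B + t ≤ - N) (y : ℤ) (hyB : B ≤ y) (hyN : y + t < N) (hyN' : -N ≤ y) (hy : y ∈ S) (hy' : y + t ∉ S) :
    Gh t (mv S y (y + t)) = Gh t S * (((ht t B y : ℂ) + 1)⁻¹ *
      ∏ j ∈ ((trun B N S).erase y).filter (fun j => y % t = j % t),
        (((ht t B y : ℂ) + 1 - ht t B j) / ((ht t B y : ℂ) - ht t B j))) := by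
  have hM : Maya N (mv S y (y + t)) := by
    constructor
    · intro n hn
      exact Or.inr ⟨hS.1 n hn, by omega⟩
    · rintro n hn (h | ⟨h, _⟩)
      · omega
      · exact hS.2 n hn h
  rw [Gh_eq t htp hM (B := B) (by omega), Gh_eq t htp hS (B := B) (by omega)]
  have e1 : trun B N (mv S y (y + t)) = insert (y + t) ((trun B N S).erase y) := by
    ext n
    simp only [mem_trun' hM, Finset.mem_insert, Finset.mem_erase, mem_trun' hS, mem_mv]
    constructor
    · rintro ⟨h1, h | h⟩
      · exact Or.inl h
      · exact Or.inr ⟨h.2, h1, h.1⟩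
    · rintro (h | h)
      · exact ⟨by omega, Or.inl h⟩
      · exact ⟨h.2.1, Or.inr ⟨h.2.2, h.1⟩⟩
  have e2 : trun B N S = insert y ((trun B N S).erase y) := by
    rw [Finset.insert_erase ((mem_trun' hS).2 ⟨by omega, hy⟩)]
  have h := (gam_move t htp B ((trun B N S).erase y) y
    (by simp) 
    (by simp only [Finset.mem_erase, mem_trun' hS]; tauto) (by
      intro j hj
      simp only [Finset.mem_erase, mem_trun' hS] at hj
      exact hj.2.1) (by omega)).2
  rw [e1, h, ← e2]

open scoped Classical in
theorem down_sum (t : ℕ) (htp : 0 < t) (M : ℤ) (S : Set ℤ) (hS : Maya M S) (I : Finset ℤ)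
    (hI : ∀ y ∈ S, y - t ∉ S → y ∈ I) :
    ∑ y ∈ I.filter (fun y => y ∈ S ∧ y - t ∉ S), Gh t (mv S y (y - t)) =
      ((hooks t S).ncard : ℂ) * Gh t S := by
  obtain ⟨N, hN⟩ : ∃ N : ℤ, N = |M| + t := ⟨_, rfl⟩
  obtain ⟨B, hB⟩ : ∃ B : ℤ, B = -N - t := ⟨_, rfl⟩
  have hMN : M ≤ |M| := le_abs_self M
  have hS' : Maya N S := hS.mono (by omega)
  set L := trun B N S with hL
  have hLB : ∀ y ∈ L, B ≤ y := fun y hy => ((mem_trun' hS').1 hy).1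
  set c : ℤ → ℂ := fun y => (ht t B y : ℂ) *
      ∏ j ∈ (L.erase y).filter (fun j => y % t = j % t),
        (((ht t B y : ℂ) - 1 - ht t B j) / ((ht t B y : ℂ) - ht t B j)) with hc
  have s1 : ∑ y ∈ I.filter (fun y => y ∈ S ∧ y - t ∉ S), Gh t (mv S y (y - t)) =
      ∑ y ∈ L.filter (fun y : ℤ => y - t ∉ S), Gh t S * c y := by
    refine Finset.sum_congr ?_ ?_
    · ext y
      simp only [Finset.mem_filter, hL, mem_trun' hS']
      constructor
      · rintro ⟨_, h1, h2⟩
        refine ⟨⟨?_, h1⟩, h2⟩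
        by_contra h
        exact h2 (hS'.1 _ (by omega))
      · rintro ⟨⟨_, h1⟩, h2⟩
        exact ⟨hI y h1 h2, h1, h2⟩
    · intro y hy
      simp only [Finset.mem_filter, hL, mem_trun] at hy
      exact down_move t htp B N S hS' (by omega) y (by omega) hy.1.2 hy.2
  have s2 : ∑ y ∈ L.filter (fun y : ℤ => y - t ∉ S), Gh t S * c y = ∑ y ∈ L, Gh t S * c y := by
    rw [Finset.sum_filter]
    refine Finset.sum_congr rfl fun y hy => ?_
    split_ifs with h
    swap
    · rfl
    · symm
      have hcy : c y = 0 := by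
        by_cases hyB : B ≤ y - t
        · rw [hc]
          refine mul_eq_zero_of_right _ (Finset.prod_eq_zero (i := y - t) ?_ ?_)
          · simp only [Finset.mem_filter, Finset.mem_erase, hL, mem_trun' hS']
            refine ⟨⟨by omega, hyB, h⟩, by simp⟩
          · have := ht_add t htp B (y - t) hyB
            rw [sub_add_cancel] at this
            rw [this]; push_cast; simp
        · rw [hc]
          refine mul_eq_zero_of_left ?_ _
          have : ht t B y = 0 := by
            rw [ht]
            have := hLB y hy
            rw [Int.ediv_eq_zero_of_lt (by omega) (by omega)]; rfl
          rw [this]; simp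
      rw [hcy, mul_zero]
  rw [s1, s2, ← Finset.mul_sum, mul_comm]
  congr 1
  have hcard := hooks_ncard t htp hS' (B := B) (by omega)
  have hcard' : ((hooks t S).ncard : ℂ) = ∑ y ∈ L, ((ht t B y : ℂ) -
      ((L.filter (fun j => j < y ∧ y % t = j % t)).card : ℂ)) := by
    exact_mod_cast congrArg (fun z : ℤ => (z : ℂ)) hcard
  rw [hcard', sum_classes t htp L, sum_classes t htp L (fun y => (ht t B y : ℂ) - _)]
  refine Finset.sum_congr rfl fun ρ _ => ?_
  have h1 := lag_down (fun y => (ht t B y : ℂ)) (L.filter (fun y => y % t = ρ))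
    (trun_inj t htp B L hLB ρ)
  rw [Finset.sum_sub_distrib]
  have h2 := choose_two_pairs (L.filter (fun y => y % t = ρ))
  have h3 : ∑ y ∈ L.filter (fun y => y % t = ρ), ((L.filter (fun j => j < y ∧ y % t = j % t)).card : ℂ)
      = ((L.filter (fun y => y % t = ρ)).card.choose 2 : ℂ) := by
    rw [← h2]
    push_cast
    refine Finset.sum_congr rfl fun y hy => ?_
    congr 2
    ext j
    simp only [Finset.mem_filter] at hy ⊢
    rw [hy.2]
    tauto
  rw [h3, ← h1]
  refine Finset.sum_congr rfl fun y hy => ?_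
  simp only [hc]
  rw [cls_erase t L y ρ (Finset.mem_filter.1 hy).2]

open scoped Classical in
theorem up_sum (t : ℕ) (htp : 0 < t) (M : ℤ) (S : Set ℤ) (hS : Maya M S) (I : Finset ℤ)
    (hI : ∀ y ∈ S, y + t ∉ S → y ∈ I) :
    ∑ y ∈ I.filter (fun y => y ∈ S ∧ y + t ∉ S), Gh t (mv S y (y + t)) = (t : ℂ) * Gh t S := by
  obtain ⟨N, hN⟩ : ∃ N : ℤ, N = |M| + t := ⟨_, rfl⟩
  obtain ⟨B, hB⟩ : ∃ B : ℤ, B = -N - t := ⟨_, rfl⟩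
  have hMN : M ≤ |M| := le_abs_self M
  have hS' : Maya N S := hS.mono (by omega)
  set L := trun B N S with hL
  have hLB : ∀ y ∈ L, B ≤ y := fun y hy => ((mem_trun' hS').1 hy).1
  set c : ℤ → ℂ := fun y => ((ht t B y : ℂ) + 1)⁻¹ *
      ∏ j ∈ (L.erase y).filter (fun j => y % t = j % t),
        (((ht t B y : ℂ) + 1 - ht t B j) / ((ht t B y : ℂ) - ht t B j)) with hc
  have ht0 : (0 : ℤ) < t := by exact_mod_cast htp
  have s1 : ∑ y ∈ I.filter (fun y => y ∈ S ∧ y + t ∉ S), Gh t (mv S y (y + t)) =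
      ∑ y ∈ L.filter (fun y : ℤ => y + t ∉ S), Gh t S * c y := by
    refine Finset.sum_congr ?_ ?_
    · ext y
      simp only [Finset.mem_filter, hL, mem_trun' hS']
      constructor
      · rintro ⟨_, h1, h2⟩
        refine ⟨⟨?_, h1⟩, h2⟩
        by_contra h
        exact h2 (hS'.1 _ (by omega))
      · rintro ⟨⟨_, h1⟩, h2⟩
        exact ⟨hI y h1 h2, h1, h2⟩
    · intro y hy
      simp only [Finset.mem_filter, hL, mem_trun] at hy
      have hyM : y < M := by
        by_contra h; exact hS.2 y (by omega) hy.1.2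
      have hyM' : -M ≤ y + t := by
        by_contra h; exact hy.2 (hS.1 _ (by omega))
      exact up_move t htp B N S hS' (by omega) y (by omega) (by omega) (by omega) hy.1.2 hy.2
  have s2 : ∑ y ∈ L.filter (fun y : ℤ => y + t ∉ S), Gh t S * c y = ∑ y ∈ L, Gh t S * c y := by
    rw [Finset.sum_filter]
    refine Finset.sum_congr rfl fun y hy => ?_
    split_ifs with h
    swap
    · rfl
    · symm
      have hcy : c y = 0 := by
        rw [hc]
        refine mul_eq_zero_of_right _ (Finset.prod_eq_zero (i := y + t) ?_ ?_)
        · simp only [Finset.mem_filter, Finset.mem_erase, hL, mem_trun' hS']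
          have := hLB y hy
          refine ⟨⟨by omega, by omega, h⟩, by simp⟩
        · rw [ht_add t htp B y (hLB y hy)]; push_cast; simp
      rw [hcy, mul_zero]
  rw [s1, s2, ← Finset.mul_sum, mul_comm]
  congr 1
  rw [sum_classes t htp]
  have : ∀ ρ ∈ Finset.Ico (0:ℤ) t, ∑ y ∈ L.filter (fun y => y % t = ρ), c y = 1 := by
    intro ρ hρ
    rw [Finset.mem_Ico] at hρ
    have hb1 : (B + (ρ - B) % t) % t = ρ := by
      rw [Int.add_emod_emod, add_sub_cancel]
      exact Int.emod_eq_of_lt hρ.1 hρ.2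
    have hb2 := Int.emod_nonneg (ρ - B) ht0.ne'
    have hb3 := Int.emod_lt_of_pos (ρ - B) ht0
    have h1 := lag_up (fun y => (ht t B y : ℂ)) (L.filter (fun y => y % t = ρ))
      (trun_inj t htp B L hLB ρ) (B + (ρ - B) % t)
      (by
        rw [Finset.mem_filter]
        refine ⟨(mem_trun' hS').2 ⟨by omega, hS'.1 _ (by omega)⟩, hb1⟩)
      (by
        have : ht t B (B + (ρ - B) % t) = 0 := by
          rw [ht, add_sub_cancel_left, Int.ediv_eq_zero_of_lt hb2 hb3]; rfl
        simp [this])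
      (fun i _ => Nat.cast_add_one_ne_zero _)
    rw [← h1]
    refine Finset.sum_congr rfl fun y hy => ?_
    simp only [hc]
    rw [cls_erase t L y ρ (Finset.mem_filter.1 hy).2]
  rw [Finset.sum_congr rfl this]
  simp

lemma hook_gap (t : ℕ) (p q : ℤ) (h : q < p) (hm : p % t = q % t) : q + t ≤ p := by
  have h1 : (t : ℤ) ∣ p - q := Int.dvd_of_emod_eq_zero (Int.emod_emod_of_dvd _ (dvd_refl _) ▸ Int.emod_eq_emod_iff_emod_sub_eq_zero.1 hm)
  have := Int.le_of_dvd (by omega) h1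
  omega

lemma swap_mod (t : ℕ) (y n : ℤ) : (Equiv.swap y (y - t) n) % t = n % t := by
  rw [Equiv.swap_apply_def]
  split_ifs with h1 h2
  · subst h1; simp
  · subst h2; simp
  · rfl

lemma swap_mem_mv (t : ℕ) (htp : 0 < t) (S : Set ℤ) (y : ℤ) (hy : y ∈ S) (hy' : y - t ∉ S) (n : ℤ) :
    Equiv.swap y (y - t) n ∈ mv S y (y - t) ↔ n ∈ S := by
  rw [Equiv.swap_apply_def, mem_mv]
  split_ifs with h1 h2
  · subst h1; simp [hy]
  · subst h2
    simp only [ne_eq, not_true_eq_false, and_false, or_false]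
    constructor
    · intro h; omega
    · intro h; exact absurd h hy'
  · tauto

lemma swap_lt (t : ℕ) (htp : 0 < t) (y p q : ℤ) (h : q < p) (hm : p % t = q % t)
    (hne : ¬ (p = y ∧ q = y - t)) : Equiv.swap y (y - t) q < Equiv.swap y (y - t) p := by
  have := hook_gap t p q h hm
  rw [Equiv.swap_apply_def, Equiv.swap_apply_def]
  by_cases hp : p = y
  · have h2 := hook_gap t (p - t) q (by omega) (by simpa using hm)
    split_ifs <;> omega
  · by_cases hq : q = y - t
    · have h2 := hook_gap t p (q + t) (by omega) (by simpa using hm)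
      split_ifs <;> omega
    · split_ifs <;> omega

lemma ncard_move (t : ℕ) (htp : 0 < t) (M : ℤ) (S : Set ℤ) (hS : Maya M S) (y : ℤ)
    (hy : y ∈ S) (hy' : y - t ∉ S) :
    (hooks t (mv S y (y - t))).ncard + 1 = (hooks t S).ncard := by
  have hmem : (y, y - (t : ℤ)) ∈ hooks t S := ⟨hy, hy', by simp; omega, by simp⟩
  rw [← Set.ncard_sdiff_singleton_add_one hmem (hooks_finite t hS)]
  congr 1
  set σ := Equiv.swap y (y - (t:ℤ)) with hσ
  rw [← Set.ncard_image_of_injective (hooks t S \ {(y, y - (t : ℤ))}) (σ.prodCongr σ).injective]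
  congr 1
  ext ⟨p, q⟩
  simp only [Set.mem_image, Set.mem_sdiff, Set.mem_singleton_iff, Prod.exists, Equiv.prodCongr_apply,
    Prod.map_apply, Prod.mk.injEq]
  constructor
  · rintro ⟨h1, h2, h3, h4⟩
    simp only at h1 h2 h3 h4
    refine ⟨σ p, σ q, ⟨⟨?_, ?_, ?_, ?_⟩, ?_⟩, by simp [hσ], by simp [hσ]⟩
    · rw [← swap_mem_mv t htp S y hy hy']; simpa [hσ] using h1
    · rw [← swap_mem_mv t htp S y hy hy']; simpa [hσ] using h2
    · refine swap_lt t htp y p q h3 h4 ?_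
      rintro ⟨rfl, _⟩
      rcases h1 with h | h
      · omega
      · exact h.2 rfl
    · simp only [hσ, swap_mod, h4]
    · rintro ⟨h5, h6⟩
      have : p = y - t := by
        have := congrArg σ h5
        simpa [hσ] using this
      have : q = y := by
        have := congrArg σ h6
        simpa [hσ] using this
      omega
  · rintro ⟨p, q, ⟨⟨h1, h2, h3, h4⟩, h5⟩, rfl, rfl⟩
    simp only at h1 h2 h3 h4
    refine ⟨?_, ?_, ?_, ?_⟩
    · exact (swap_mem_mv t htp S y hy hy' p).2 h1
    · exact fun h => h2 ((swap_mem_mv t htp S y hy hy' q).1 h)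
    · exact swap_lt t htp y p q h3 h4 h5
    · simp only [hσ, swap_mod, h4]

/-- symmetric bead configuration -/
def XA (A : Finset ℕ) : Set ℤ := {y | (0 < y ∧ y.natAbs ∈ A) ∨ (y < 0 ∧ y.natAbs ∉ A)}

lemma mem_XA {A : Finset ℕ} {y : ℤ} :
    y ∈ XA A ↔ (0 < y ∧ y.natAbs ∈ A) ∨ (y < 0 ∧ y.natAbs ∉ A) := Iff.rfl

lemma XA_neg {A : Finset ℕ} {y : ℤ} (hy : y ≠ 0) : -y ∈ XA A ↔ y ∉ XA A := by
  rw [mem_XA, mem_XA, Int.natAbs_neg]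
  by_cases h : y.natAbs ∈ A <;> simp [h] <;> omega

lemma XA_zero {A : Finset ℕ} : (0 : ℤ) ∉ XA A := by simp [mem_XA]

lemma XA_maya (A : Finset ℕ) (M : ℕ) (h : ∀ a ∈ A, a < M) : Maya M (XA A) := by
  constructor
  · intro n hn
    refine Or.inr ⟨by omega, fun h2 => ?_⟩
    have := h _ h2; omega
  · rintro n hn (h2 | h2)
    · have := h _ h2.2; omega
    · omega

lemma XA_maya' (A : Finset ℕ) : Maya ((A.sum id + 1 : ℕ) : ℤ) (XA A) := by
  refine XA_maya A _ fun a ha => ?_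
  have := Finset.single_le_sum (f := id) (s := A) (by simp) ha
  simp at this ⊢
  omega

def wt (t : ℕ) (A : Finset ℕ) : ℕ := (hooks t (XA A)).ncard

/-- number of hooks with negative sign -/
def Nn (t : ℕ) (A : Finset ℕ) : ℕ := ({p ∈ hooks t (XA A) | p.1 + p.2 < 0}).ncard

def phi (t' : ℕ) (a : ℕ) : ℤ := 2 - (if 2 * t' ∣ a then 1 else 0) - (if t' ∣ a then 1 else 0)

def Sg (t : ℕ) (A : Finset ℕ) : ℂ := (-1) ^ (A.card + Nn t A)

lemma Nn_formula (t' : ℕ) (htp : 0 < t') (A : Finset ℕ) (hA : 0 ∉ A) :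
    (wt (2 * t') A : ℤ) + ∑ a ∈ A, phi t' a = 2 * (A.card + Nn (2 * t') A : ℕ) := by
  set t := 2 * t' with ht
  set H := hooks t (XA A) with hH
  have hfin : H.Finite := hooks_finite t (XA_maya' A)
  set Hf := hfin.toFinset with hHf
  have hmem : ∀ p, p ∈ Hf ↔ p.1 ∈ XA A ∧ p.2 ∉ XA A ∧ p.2 < p.1 ∧ p.1 % t = p.2 % t := by
    intro p; rw [hHf, Set.Finite.mem_toFinset]; rfl
  have e1 : wt t A = Hf.card := Set.ncard_eq_toFinset_card _ hfin
  have e2 : Nn t A = (Hf.filter (fun p => p.1 + p.2 < 0)).card := by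
    rw [← Set.ncard_coe_finset, Nn]
    congr 1
    ext p
    simp [hHf, ← hH]
  -- partition
  have e3 : Hf.card = (Hf.filter (fun p => p.1 + p.2 < 0)).card +
      (Hf.filter (fun p => 0 < p.1 + p.2 ∧ p.2 ≠ 0)).card +
      (Hf.filter (fun p => p.1 + p.2 = 0)).card + (Hf.filter (fun p => p.2 = 0)).card := by
    simp only [Finset.card_filter, ← Finset.sum_add_distrib]
    rw [Finset.card_eq_sum_ones]
    refine Finset.sum_congr rfl fun p hp => ?_
    rw [hmem] at hp
    have h0 : p.1 ≠ 0 := fun h => XA_zero (h ▸ hp.1)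
    split_ifs <;> omega
  have e4 : (Hf.filter (fun p => 0 < p.1 + p.2 ∧ p.2 ≠ 0)).card =
      (Hf.filter (fun p => p.1 + p.2 < 0)).card := by
    have hneg : ∀ p ∈ Hf, p.2 ≠ 0 → (-p.2, -p.1) ∈ Hf := by
      intro p hp h0
      rw [hmem] at hp ⊢
      have h1 : p.1 ≠ 0 := fun h => XA_zero (h ▸ hp.1)
      refine ⟨(XA_neg h0).2 hp.2.1, fun h => (XA_neg h1).1 h hp.1, by simp; exact hp.2.2.1, ?_⟩
      exact (Int.ModEq.neg hp.2.2.2).symm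
    refine Finset.card_nbij' (fun p => (-p.2, -p.1)) (fun p => (-p.2, -p.1)) ?_ ?_ ?_ ?_
    · intro p hp
      simp only [Finset.coe_filter, Set.mem_ofPred_eq] at hp ⊢
      exact ⟨hneg p hp.1 hp.2.2, by omega⟩
    · intro p hp
      simp only [Finset.coe_filter, Set.mem_ofPred_eq] at hp ⊢
      have hp' := (hmem p).1 hp.1
      have h1 : p.1 ≠ 0 := fun h => XA_zero (h ▸ hp'.1)
      refine ⟨hneg p hp.1 ?_, by omega, by omega⟩
      intro h
      rcases hp'.1 with h5 | h5
      · omega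
      · omega
    · intro p _; simp
    · intro p _; simp
  have e5 : (Hf.filter (fun p => p.1 + p.2 = 0)).card = (A.filter (fun a => t' ∣ a)).card := by
    refine Finset.card_nbij' (fun p => p.1.natAbs) (fun a => ((a : ℤ), -(a : ℤ))) ?_ ?_ ?_ ?_
    · intro p hp
      simp only [Finset.coe_filter, Set.mem_ofPred_eq, hmem] at hp ⊢
      obtain ⟨⟨h1, h2, h3, h4⟩, h5⟩ := hp
      refine ⟨?_, ?_⟩
      · rcases h1 with h | h
        · exact h.2
        · omega
      · have e : p.2 = -p.1 := by omega
        rw [e] at h4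
        have := Int.emod_eq_emod_iff_emod_sub_eq_zero.1 h4
        have h6 := Int.dvd_of_emod_eq_zero this
        rw [sub_neg_eq_add, ← two_mul, ht] at h6
        push_cast at h6
        have h7 := (mul_dvd_mul_iff_left (two_ne_zero)).1 h6
        exact Int.natCast_dvd.1 h7
    · intro a ha
      simp only [Finset.coe_filter, Set.mem_ofPred_eq, hmem] at ha ⊢
      have h0 : a ≠ 0 := fun h => hA (h ▸ ha.1)
      have h1 : (a : ℤ) ∈ XA A := Or.inl ⟨by omega, by simpa using ha.1⟩
      refine ⟨⟨h1, fun h => (XA_neg (by omega)).1 h h1, by omega, ?_⟩, by omega⟩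
      apply Int.emod_eq_emod_iff_emod_sub_eq_zero.2
      apply Int.emod_eq_zero_of_dvd
      rw [sub_neg_eq_add, ← two_mul, ht]
      push_cast
      exact mul_dvd_mul_left _ (Int.natCast_dvd_natCast.2 ha.2)
    · intro p hp
      simp only [Finset.coe_filter, Set.mem_ofPred_eq, hmem] at hp ⊢
      refine Prod.ext_iff.2 ⟨?_, ?_⟩ <;> dsimp only <;> omega
    · intro a _; simp
  have e6 : (Hf.filter (fun p => p.2 = 0)).card = (A.filter (fun a => t ∣ a)).card := by
    refine Finset.card_nbij' (fun p => p.1.natAbs) (fun a => ((a : ℤ), (0 : ℤ))) ?_ ?_ ?_ ?_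
    · intro p hp
      simp only [Finset.coe_filter, Set.mem_ofPred_eq, hmem] at hp ⊢
      obtain ⟨⟨h1, h2, h3, h4⟩, h5⟩ := hp
      refine ⟨?_, ?_⟩
      · rcases h1 with h | h
        · exact h.2
        · omega
      · rw [h5, Int.zero_emod] at h4
        exact Int.natCast_dvd.1 (Int.dvd_of_emod_eq_zero h4)
    · intro a ha
      simp only [Finset.coe_filter, Set.mem_ofPred_eq, hmem] at ha ⊢
      have h0 : a ≠ 0 := fun h => hA (h ▸ ha.1)
      have h1 : (a : ℤ) ∈ XA A := Or.inl ⟨by omega, by simpa using ha.1⟩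
      refine ⟨⟨h1, XA_zero, by omega, ?_⟩, trivial⟩
      rw [Int.zero_emod]
      exact Int.emod_eq_zero_of_dvd (Int.natCast_dvd_natCast.2 ha.2)
    · intro p hp
      simp only [Finset.coe_filter, Set.mem_ofPred_eq, hmem] at hp ⊢
      refine Prod.ext_iff.2 ⟨?_, ?_⟩ <;> dsimp only <;> omega
    · intro a _; simp
  have e7 : ∑ a ∈ A, phi t' a = 2 * A.card - (A.filter (fun a => t ∣ a)).card -
      (A.filter (fun a => t' ∣ a)).card := by
    simp only [phi, Finset.sum_sub_distrib, Finset.card_filter, ← ht]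
    push_cast
    simp [mul_comm]
  rw [e7, e1, e2]
  push_cast
  omega

lemma sum_symmDiff (A T : Finset ℕ) (f : ℕ → ℤ) :
    ∑ a ∈ symmDiff A T, f a = ∑ a ∈ A, f a + ∑ p ∈ T, (if p ∈ A then - f p else f p) := by
  rw [show symmDiff A T = (A \ T) ∪ (T \ A) from rfl, Finset.sum_union (by
    rw [Finset.disjoint_left]; intro a h1 h2
    simp only [Finset.mem_sdiff] at h1 h2; tauto)]
  have h1 := Finset.sum_inter_add_sum_sdiff A T f
  have h2 := Finset.sum_inter_add_sum_sdiff T A (fun p => if p ∈ A then - f p else f p)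
  have h3 : ∑ p ∈ T ∩ A, (if p ∈ A then - f p else f p) = - ∑ p ∈ A ∩ T, f p := by
    rw [Finset.inter_comm, ← Finset.sum_neg_distrib]
    refine Finset.sum_congr rfl fun p hp => ?_
    rw [if_pos (Finset.mem_inter.1 hp).1]
  have h4 : ∑ p ∈ T \ A, (if p ∈ A then - f p else f p) = ∑ p ∈ T \ A, f p := by
    refine Finset.sum_congr rfl fun p hp => ?_
    rw [if_neg (Finset.mem_sdiff.1 hp).2]
  linarith

def Tg (t : ℕ) (y : ℤ) : Finset ℕ := ({y.natAbs, (y - t).natAbs} : Finset ℕ).erase 0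

lemma mem_Tg {t : ℕ} {y : ℤ} {p : ℕ} :
    p ∈ Tg t y ↔ p ≠ 0 ∧ (p = y.natAbs ∨ p = (y - t).natAbs) := by
  simp [Tg]

lemma phi_congr (t' : ℕ) (y : ℤ) : phi t' y.natAbs = phi t' (y - (2 * t' : ℕ)).natAbs := by
  have h1 : (2 * t' ∣ y.natAbs) ↔ (2 * t' ∣ (y - (2 * t' : ℕ)).natAbs) := by
    rw [← Int.natCast_dvd, ← Int.natCast_dvd]; simp
  have h2 : (t' ∣ y.natAbs) ↔ (t' ∣ (y - (2 * t' : ℕ)).natAbs) := by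
    rw [← Int.natCast_dvd, ← Int.natCast_dvd]
    rw [dvd_sub_left]
    push_cast
    exact Dvd.intro_left _ rfl
  simp only [phi, h1, h2]

lemma phi_mid (t' : ℕ) (y : ℤ) (h0 : 0 < y) (h1 : y < (2 * t' : ℕ)) (h2 : y ≠ t') :
    phi t' y.natAbs = 2 := by
  have h4 : ¬ t' ∣ y.natAbs := by
    rintro ⟨k, hk⟩
    have : y = t' * k := by omega
    rcases Nat.lt_or_ge k 2 with h | h
    · interval_cases k <;> simp at this <;> omega
    · have : (t' : ℤ) * 2 ≤ t' * k := by
        apply mul_le_mul_of_nonneg_left <;> omega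
      push_cast at h1
      omega
  have h3 : ¬ 2 * t' ∣ y.natAbs := fun h => h4 (dvd_trans (Dvd.intro_left _ rfl) h)
  simp [phi, h3, h4]

lemma tog_mem (A T : Finset ℕ) (n : ℤ) (hn : n ≠ 0) (h : n.natAbs ∈ T) :
    n ∈ XA (symmDiff A T) ↔ n ∉ XA A := by
  simp only [mem_XA, Finset.mem_symmDiff, h]
  by_cases h2 : n.natAbs ∈ A <;> simp [h2] <;> omega

lemma tog_mem' (A T : Finset ℕ) (n : ℤ) (h : n.natAbs ∉ T) :
    n ∈ XA (symmDiff A T) ↔ n ∈ XA A := by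
  simp only [mem_XA, Finset.mem_symmDiff, h]
  simp

lemma Sg_flip (t' : ℕ) (htp : 0 < t') (A B : Finset ℕ) (hA : 0 ∉ A) (hB : 0 ∉ B) (k : ℤ)
    (h : (wt (2 * t') A : ℤ) + ∑ a ∈ A, phi t' a = wt (2 * t') B + ∑ a ∈ B, phi t' a + 2 + 4 * k)
    : Sg (2 * t') A = - Sg (2 * t') B := by
  rw [Nn_formula t' htp A hA, Nn_formula t' htp B hB] at h
  rw [Sg, Sg]
  rcases Nat.even_or_odd (B.card + Nn (2 * t') B) with h1 | h1
  · have h2 : Odd (A.card + Nn (2 * t') A) := by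
      obtain ⟨m, hm⟩ := h1
      rw [Nat.odd_iff]; omega
    rw [h1.neg_one_pow, h2.neg_one_pow]
  · have h2 : Even (A.card + Nn (2 * t') A) := by
      obtain ⟨m, hm⟩ := h1
      rw [Nat.even_iff]; omega
    rw [h1.neg_one_pow, h2.neg_one_pow]; simp

lemma tog_zero (A : Finset ℕ) (hA : 0 ∉ A) (t : ℕ) (y : ℤ) : 0 ∉ symmDiff A (Tg t y) := by
  simp [Finset.mem_symmDiff, hA, mem_Tg]

lemma tog_move (t' : ℕ) (htp : 0 < t') (A : Finset ℕ) (y : ℤ) (hy : y ≠ t') :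
    (-y ∈ XA (symmDiff A (Tg (2 * t') y)) ∧ -y + (2 * t' : ℕ) ∉ XA (symmDiff A (Tg (2 * t') y)))
      ↔ (y ∈ XA A ∧ y - (2 * t' : ℕ) ∉ XA A) := by
  set t := 2 * t' with ht
  have e : -y + (t : ℤ) = -(y - t) := by ring
  rw [e]
  by_cases h0 : y = 0
  · subst h0; simp [XA_zero]
  have h1 : y.natAbs ∈ Tg t y := mem_Tg.2 ⟨by omega, Or.inl rfl⟩
  rw [XA_neg h0, tog_mem _ _ _ h0 h1, not_not]
  refine and_congr_right fun _ => ?_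
  by_cases h2 : y - t = 0
  · rw [h2, neg_zero]; simp [XA_zero]
  have h3 : (y - t).natAbs ∈ Tg t y := mem_Tg.2 ⟨by omega, Or.inr rfl⟩
  rw [XA_neg h2, tog_mem _ _ _ h2 h3, not_not]

lemma tog_mv (t' : ℕ) (htp : 0 < t') (A : Finset ℕ) (y : ℤ) (hy : y ≠ t')
    (h1 : y ∈ XA A) (h2 : y - (2 * t' : ℕ) ∉ XA A) :
    mv (XA A) y (y - (2 * t' : ℕ)) =
      mv (XA (symmDiff A (Tg (2 * t') y))) (-y) (-y + (2 * t' : ℕ)) := by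
  obtain ⟨h3, h4⟩ := (tog_move t' htp A y hy).2 ⟨h1, h2⟩
  set t := 2 * t' with ht
  have h0 : y ≠ 0 := fun h => XA_zero (h ▸ h1)
  have hT1 : y.natAbs ∈ Tg t y := mem_Tg.2 ⟨by omega, Or.inl rfl⟩
  have e : -y + (t : ℤ) = -(y - t) := by ring
  ext n
  rw [mem_mv, mem_mv]
  by_cases hn : n.natAbs ∈ Tg t y
  · obtain ⟨hn0, hn1⟩ := mem_Tg.1 hn
    rw [tog_mem _ _ _ (by omega) hn]
    have : n = y ∨ n = -y ∨ n = y - t ∨ n = -y + t := by omega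
    rcases this with rfl | rfl | rfl | rfl
    · simp [h1]; omega
    · have : -y ∉ XA A := by rw [XA_neg h0]; simpa using h1
      simp [this]; omega
    · simp [h2]; omega
    · have : -y + t ∈ XA A := by
        rw [e, XA_neg (by omega)]; exact h2
      simp [this]; omega
  · rw [tog_mem' _ _ _ hn]
    rw [mem_Tg] at hn
    by_cases hn0 : n = 0
    · subst hn0
      simp [XA_zero]
      omega
    · have : n ≠ y ∧ n ≠ -y ∧ n ≠ y - t ∧ n ≠ -y + t := by omega
      simp [this]

open scoped Classical in
lemma tog_contrib (A : Finset ℕ) (n : ℤ) (h : n ≠ 0) (f : ℕ → ℤ) :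
    (if n.natAbs ∈ A then - f n.natAbs else f n.natAbs) =
      if n ∈ XA A then - (n.sign * f n.natAbs) else n.sign * f n.natAbs := by
  rcases lt_or_gt_of_ne h with h1 | h1
  · have : n ∈ XA A ↔ n.natAbs ∉ A := by simp [mem_XA, h1]; omega
    rw [this, Int.sign_eq_neg_one_of_neg h1]
    by_cases h2 : n.natAbs ∈ A <;> simp [h2]
  · have : n ∈ XA A ↔ n.natAbs ∈ A := by simp [mem_XA, h1]; omega
    rw [this, Int.sign_eq_one_of_pos h1]
    by_cases h2 : n.natAbs ∈ A <;> simp [h2]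

lemma tog_sum (t' : ℕ) (htp : 0 < t') (A : Finset ℕ) (y : ℤ) (hy : y ≠ t')
    (h1 : y ∈ XA A) (h2 : y - (2 * t' : ℕ) ∉ XA A) (f : ℕ → ℤ) (hf : f 0 = 0) :
    ∑ a ∈ symmDiff A (Tg (2 * t') y), f a = ∑ a ∈ A, f a - y.sign * f y.natAbs +
      (y - (2 * t' : ℕ)).sign * f (y - (2 * t' : ℕ)).natAbs := by
  set t := 2 * t' with ht
  have h0 : y ≠ 0 := fun h => XA_zero (h ▸ h1)
  rw [sum_symmDiff]
  by_cases hyt : y - t = 0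
  · have : Tg t y = {y.natAbs} := by
      ext p; rw [mem_Tg, Finset.mem_singleton, hyt]; omega
    rw [this, Finset.sum_singleton, hyt, tog_contrib A y h0, if_pos h1]
    simp; ring
  · have : Tg t y = {y.natAbs, (y - t).natAbs} := by
      ext p; rw [mem_Tg, Finset.mem_insert, Finset.mem_singleton]; omega
    rw [this, Finset.sum_pair (by omega), tog_contrib A y h0, if_pos h1,
      tog_contrib A _ hyt, if_neg h2]
    ring

lemma tog_sum_id (t' : ℕ) (htp : 0 < t') (A : Finset ℕ) (y : ℤ) (hy : y ≠ t')
    (h1 : y ∈ XA A) (h2 : y - (2 * t' : ℕ) ∉ XA A) :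
    ∑ a ∈ symmDiff A (Tg (2 * t') y), (a : ℤ) = ∑ a ∈ A, (a : ℤ) - (2 * t' : ℕ) := by
  have := tog_sum t' htp A y hy h1 h2 (fun a => (a : ℤ)) rfl
  rw [this]
  simp only [Int.sign_mul_natAbs]
  ring

lemma tog_wt (t' : ℕ) (htp : 0 < t') (A : Finset ℕ) (y : ℤ) (hy : y ≠ t')
    (h1 : y ∈ XA A) (h2 : y - (2 * t' : ℕ) ∉ XA A) :
    wt (2 * t') (symmDiff A (Tg (2 * t') y)) + 2 = wt (2 * t') A := by
  obtain ⟨h3, h4⟩ := (tog_move t' htp A y hy).2 ⟨h1, h2⟩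
  have h5 := tog_mv t' htp A y hy h1 h2
  set t := 2 * t' with ht
  set B := symmDiff A (Tg t y)
  have e1 := ncard_move t (by omega) _ (XA A) (XA_maya' A) y h1 h2
  have hm : Maya (((B.sum id + 1 : ℕ) : ℤ) + |y| + t) (mv (XA B) (-y) (-y + t)) := by
    have hM := XA_maya' B
    have := le_abs_self y
    have := neg_abs_le y
    constructor
    · intro n hn
      exact Or.inr ⟨hM.1 n (by omega), by omega⟩
    · rintro n hn (h | h)
      · omega
      · exact hM.2 n (by omega) h.1
  have e2 := ncard_move t (by omega) _ _ hm (-y + t) (Or.inl rfl)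
    (by rintro (h | h)
        · omega
        · exact h.2 (by ring))
  have e3 : mv (mv (XA B) (-y) (-y + t)) (-y + t) (-y + t - t) = XA B := by
    ext n
    rw [mem_mv, mem_mv]
    by_cases hn : n = -y
    · subst hn; simp [h3]
    · by_cases hn2 : n = -y + t
      · subst hn2; simp [h4]; omega
      · simp [hn, hn2]
  rw [e3, ← h5] at e2
  unfold wt
  omega

lemma phi_zero (t' : ℕ) : phi t' 0 = 0 := by simp [phi]

lemma phi_t (t' : ℕ) : phi t' (2 * t') = 0 := by simp [phi]

lemma tog_Sg (t' : ℕ) (htp : 0 < t') (A : Finset ℕ) (hA : 0 ∉ A) (y : ℤ) (hy : y ≠ t')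
    (h1 : y ∈ XA A) (h2 : y - (2 * t' : ℕ) ∉ XA A) :
    Sg (2 * t') A = - Sg (2 * t') (symmDiff A (Tg (2 * t') y)) := by
  have e1 := tog_wt t' htp A y hy h1 h2
  have e2 := tog_sum t' htp A y hy h1 h2 (phi t') (phi_zero t')
  rw [← phi_congr] at e2
  have h0 : y ≠ 0 := fun h => XA_zero (h ▸ h1)
  rcases lt_or_gt_of_ne h0 with h | h
  · rw [Int.sign_eq_neg_one_of_neg h, Int.sign_eq_neg_one_of_neg (by omega)] at e2
    exact Sg_flip t' htp _ _ hA (tog_zero A hA _ y) 0 (by omega)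
  · rcases lt_trichotomy y ((2 * t' : ℕ) : ℤ) with h3 | h3 | h3
    · rw [Int.sign_eq_one_of_pos h, Int.sign_eq_neg_one_of_neg (by omega), phi_mid t' y h h3 hy] at e2
      exact Sg_flip t' htp _ _ hA (tog_zero A hA _ y) 1 (by omega)
    · have : y.natAbs = 2 * t' := by omega
      rw [this, phi_t] at e2
      exact Sg_flip t' htp _ _ hA (tog_zero A hA _ y) 0 (by omega)
    · rw [Int.sign_eq_one_of_pos h, Int.sign_eq_one_of_pos (by omega)] at e2
      exact Sg_flip t' htp _ _ hA (tog_zero A hA _ y) 0 (by omega)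

lemma er_XA (t' : ℕ) (htp : 0 < t') (A : Finset ℕ) (h : t' ∈ A) :
    XA (A.erase t') = mv (XA A) t' ((t' : ℤ) - (2 * t' : ℕ)) := by
  ext n
  rw [mem_mv, mem_XA, mem_XA, Finset.mem_erase]
  by_cases h1 : n.natAbs = t'
  · rw [h1]; simp [h]; omega
  · have : n ≠ t' := by omega
    have : n ≠ t' - (2 * t' : ℕ) := by omega
    simp [*]
    intro hh
    omega

lemma er_XA' (t' : ℕ) (htp : 0 < t') (A : Finset ℕ) (h : t' ∈ A) :
    XA A = mv (XA (A.erase t')) (-(t' : ℤ)) (-(t' : ℤ) + (2 * t' : ℕ)) := by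
  ext n
  rw [mem_mv, mem_XA, mem_XA, Finset.mem_erase]
  by_cases h1 : n.natAbs = t'
  · rw [h1]; simp [h]; omega
  · have : n ≠ - t' := by omega
    have : n ≠ -t' + (2 * t' : ℕ) := by omega
    simp [*]
    intro hh
    omega

lemma XA_tp (t' : ℕ) (htp : 0 < t') (A : Finset ℕ) :
    ((t' : ℤ) ∈ XA A ∧ (t' : ℤ) - (2 * t' : ℕ) ∉ XA A) ↔ t' ∈ A := by
  have e : (t' : ℤ) - (2 * t' : ℕ) = -t' := by push_cast; ring
  rw [e, XA_neg (by omega), not_not, and_self, mem_XA, Int.natAbs_natCast]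
  constructor
  · rintro (h | h)
    · exact h.2
    · omega
  · intro h; exact Or.inl ⟨by omega, h⟩

lemma XA_tp' (t' : ℕ) (htp : 0 < t') (A : Finset ℕ) :
    (-(t' : ℤ) ∈ XA A ∧ -(t' : ℤ) + (2 * t' : ℕ) ∉ XA A) ↔ t' ∉ A := by
  have e : -(t' : ℤ) + (2 * t' : ℕ) = t' := by push_cast; ring
  rw [e, XA_neg (by omega), and_self, mem_XA, Int.natAbs_natCast, not_iff_not]
  constructor
  · rintro (h | h)
    · exact h.2
    · omega
  · intro h; exact Or.inl ⟨by omega, h⟩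

lemma er_wt (t' : ℕ) (htp : 0 < t') (A : Finset ℕ) (h : t' ∈ A) :
    wt (2 * t') (A.erase t') + 1 = wt (2 * t') A := by
  obtain ⟨h1, h2⟩ := (XA_tp t' htp A).2 h
  have := ncard_move (2 * t') (by omega) _ _ (XA_maya' A) t' h1 h2
  rw [← er_XA t' htp A h] at this
  exact this

lemma er_Sg (t' : ℕ) (htp : 0 < t') (A : Finset ℕ) (hA : 0 ∉ A) (h : t' ∈ A) :
    Sg (2 * t') A = - Sg (2 * t') (A.erase t') := by
  refine Sg_flip t' htp _ _ hA (by simp [hA]) 0 ?_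
  have h1 := er_wt t' htp A h
  have h2 := Finset.add_sum_erase A (phi t') h
  have h3 : phi t' t' = 1 := by
    have : ¬ 2 * t' ∣ t' := fun h => by
      have := Nat.le_of_dvd htp h; omega
    simp [phi, this]
  rw [h3] at h2
  omega

lemma er_sum (t' : ℕ) (A : Finset ℕ) (h : t' ∈ A) :
    ∑ a ∈ A.erase t', (a : ℤ) = ∑ a ∈ A, (a : ℤ) - t' := by
  have h2 := Finset.add_sum_erase A (fun a => (a : ℤ)) h
  omega

open scoped Classical in
def AA (t : ℕ) (n w : ℤ) : Finset (Finset ℕ) :=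
  (Finset.Icc 1 n.toNat).powerset.filter (fun A => ∑ a ∈ A, (a : ℤ) = n ∧ (wt t A : ℤ) = w)

lemma mem_AA {t : ℕ} {n w : ℤ} {A : Finset ℕ} :
    A ∈ AA t n w ↔ 0 ∉ A ∧ ∑ a ∈ A, (a : ℤ) = n ∧ (wt t A : ℤ) = w := by
  rw [AA, Finset.mem_filter, Finset.mem_powerset]
  refine and_congr_left fun h => ?_
  constructor
  · intro h1 h2
    have := Finset.mem_Icc.1 (h1 h2); omega
  · intro h1 a ha
    have := Finset.single_le_sum (f := fun a : ℕ => (a : ℤ)) (s := A) (by simp) ha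
    have h0 : a ≠ 0 := fun h => h1 (h ▸ ha)
    rw [Finset.mem_Icc]
    omega

def aa (t : ℕ) (n w : ℤ) : ℂ := ∑ A ∈ AA t n w, Sg t A * Gh t (XA A)

lemma AA_bound {t : ℕ} {n w : ℤ} {A : Finset ℕ} (h : A ∈ AA t n w) (N : ℕ) (hN : n < N) :
    Maya N (XA A) := by
  refine XA_maya A _ fun a ha => ?_
  rw [mem_AA] at h
  have := Finset.single_le_sum (f := fun a : ℕ => (a : ℤ)) (s := A) (by simp) ha
  omega

open scoped Classical in
lemma rec_gen (t' : ℕ) (htp : 0 < t') (n w y : ℤ) (hy : y ≠ t') :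
    ∑ A ∈ AA (2 * t') n w, (if (y ∈ XA A ∧ y - (2 * t' : ℕ) ∉ XA A) then
      Sg (2 * t') A * Gh (2 * t') (mv (XA A) y (y - (2 * t' : ℕ))) else 0) =
    - ∑ B ∈ AA (2 * t') (n - (2 * t' : ℕ)) (w - 2),
      (if (-y ∈ XA B ∧ -y + (2 * t' : ℕ) ∉ XA B) then
      Sg (2 * t') B * Gh (2 * t') (mv (XA B) (-y) (-y + (2 * t' : ℕ))) else 0) := by
  rw [← Finset.sum_filter, ← Finset.sum_filter, ← Finset.sum_neg_distrib]
  refine Finset.sum_nbij' (fun A => symmDiff A (Tg (2 * t') y)) (fun A => symmDiff A (Tg (2 * t') y))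
    ?_ ?_ ?_ ?_ ?_
  · intro A hA
    simp only [Finset.mem_filter, mem_AA] at hA ⊢
    obtain ⟨⟨h0, h1, h2⟩, h3⟩ := hA
    refine ⟨⟨tog_zero A h0 _ _, ?_, ?_⟩, (tog_move t' htp A y hy).2 h3⟩
    · rw [tog_sum_id t' htp A y hy h3.1 h3.2, h1]
    · have := tog_wt t' htp A y hy h3.1 h3.2
      omega
  · intro B hB
    simp only [Finset.mem_filter, mem_AA] at hB ⊢
    obtain ⟨⟨h0, h1, h2⟩, h3⟩ := hB
    have hBB : symmDiff (symmDiff B (Tg (2 * t') y)) (Tg (2 * t') y) = B := by simp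
    have h4 := tog_move t' htp (symmDiff B (Tg (2 * t') y)) y hy
    rw [hBB] at h4
    have h5 := h4.1 h3
    have h6 := tog_sum_id t' htp _ y hy h5.1 h5.2
    have h7 := tog_wt t' htp _ y hy h5.1 h5.2
    rw [hBB] at h6 h7
    refine ⟨⟨tog_zero B h0 _ _, ?_, ?_⟩, h5⟩
    · omega
    · omega
  · intro A _; simp
  · intro A _; simp
  · intro A hA
    simp only [Finset.mem_filter, mem_AA] at hA
    obtain ⟨⟨h0, h1, h2⟩, h3⟩ := hA
    rw [tog_Sg t' htp A h0 y hy h3.1 h3.2, tog_mv t' htp A y hy h3.1 h3.2]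
    ring

open scoped Classical in
lemma er_bij (t' : ℕ) (htp : 0 < t') (n w : ℤ) (f : Finset ℕ → ℂ) :
    ∑ A ∈ (AA (2 * t') n w).filter (fun A => t' ∈ A), f (A.erase t') =
    ∑ B ∈ (AA (2 * t') (n - t') (w - 1)).filter (fun A => t' ∉ A), f B := by
  refine Finset.sum_nbij' (fun A => A.erase t') (fun A => insert t' A)
    ?_ ?_ ?_ ?_ ?_
  · intro A hA
    simp only [Finset.mem_filter, mem_AA] at hA ⊢
    obtain ⟨⟨h0, h1, h2⟩, h3⟩ := hA
    have := er_sum t' A h3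
    have := er_wt t' htp A h3
    refine ⟨⟨by simp [h0], by omega, by omega⟩, by simp⟩
  · intro B hB
    simp only [Finset.mem_filter, mem_AA] at hB ⊢
    obtain ⟨⟨h0, h1, h2⟩, h3⟩ := hB
    have e1 := er_sum t' (insert t' B) (by simp)
    have e2 := er_wt t' htp (insert t' B) (by simp)
    rw [Finset.erase_insert h3] at e1 e2
    refine ⟨⟨by simp [h0]; omega, by omega, by omega⟩, by simp⟩
  · intro A hA
    simp only [Finset.mem_filter] at hA
    simp [Finset.insert_erase hA.2]
  · intro A hA
    simp only [Finset.mem_filter] at hA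
    simp [Finset.erase_insert hA.2]
  · intro A hA; rfl

open scoped Classical in
theorem aa_rec (t' : ℕ) (htp : 0 < t') (n w : ℤ) :
    (w : ℂ) * aa (2 * t') n w =
      - aa (2 * t') (n - t') (w - 1) - (2 * t' : ℕ) * aa (2 * t') (n - (2 * t' : ℕ)) (w - 2) := by
  obtain ⟨N, hN⟩ : ∃ N : ℕ, N = n.toNat + 1 + 2 * t' := ⟨_, rfl⟩
  set I : Finset ℤ := Finset.Icc (-N) N with hI
  -- left side
  have L : (w : ℂ) * aa (2 * t') n w = ∑ y ∈ I, ∑ A ∈ AA (2 * t') n w,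
      (if (y ∈ XA A ∧ y - (2 * t' : ℕ) ∉ XA A) then
      Sg (2 * t') A * Gh (2 * t') (mv (XA A) y (y - (2 * t' : ℕ))) else 0) := by
    rw [Finset.sum_comm, aa, Finset.mul_sum]
    refine Finset.sum_congr rfl fun A hA => ?_
    have hM := AA_bound hA (n.toNat + 1) (by omega)
    have h := down_sum (2 * t') (by omega) _ _ hM I (by
      intro y h1 h2
      have a1 : y < (n.toNat + 1 : ℕ) := by
        by_contra h; exact hM.2 _ (by omega) h1
      have a2 : -((n.toNat + 1 : ℕ) : ℤ) ≤ y - (2 * t' : ℕ) := by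
        by_contra h; exact h2 (hM.1 _ (by omega))
      rw [hI, Finset.mem_Icc]; omega)
    have hw : (w : ℂ) = ((hooks (2 * t') (XA A)).ncard : ℂ) := by
      have := (mem_AA.1 hA).2.2
      rw [← this, wt]; simp
    rw [← Finset.sum_filter, ← Finset.mul_sum, h, hw]
    ring
  have R : ((2 * t' : ℕ) : ℂ) * aa (2 * t') (n - (2 * t' : ℕ)) (w - 2) =
      ∑ y ∈ I, ∑ B ∈ AA (2 * t') (n - (2 * t' : ℕ)) (w - 2),
      (if (-y ∈ XA B ∧ -y + (2 * t' : ℕ) ∉ XA B) then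
      Sg (2 * t') B * Gh (2 * t') (mv (XA B) (-y) (-y + (2 * t' : ℕ))) else 0) := by
    rw [Finset.sum_comm, aa, Finset.mul_sum]
    refine Finset.sum_congr rfl fun A hA => ?_
    have hM := AA_bound hA (n.toNat + 1) (by omega)
    have h := up_sum (2 * t') (by omega) _ _ hM I (by
      intro y h1 h2
      have a1 : y < (n.toNat + 1 : ℕ) := by
        by_contra h; exact hM.2 _ (by omega) h1
      have a2 : -((n.toNat + 1 : ℕ) : ℤ) ≤ y + (2 * t' : ℕ) := by
        by_contra h; exact h2 (hM.1 _ (by omega))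
      rw [hI, Finset.mem_Icc]; omega)
    have h2 : ∑ y ∈ I, (if (-y ∈ XA A ∧ -y + (2 * t' : ℕ) ∉ XA A) then
      Sg (2 * t') A * Gh (2 * t') (mv (XA A) (-y) (-y + (2 * t' : ℕ))) else 0) =
      ∑ y ∈ I, (if (y ∈ XA A ∧ y + (2 * t' : ℕ) ∉ XA A) then
      Sg (2 * t') A * Gh (2 * t') (mv (XA A) (y) (y + (2 * t' : ℕ))) else 0) := by
      refine Finset.sum_nbij' (fun y => -y) (fun y => -y) ?_ ?_ ?_ ?_ ?_
      · intro y hy; simp [hI] at hy ⊢; omega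
      · intro y hy; simp [hI] at hy ⊢; omega
      · intro y _; simp
      · intro y _; simp
      · intro y _; rfl
    rw [h2, ← Finset.sum_filter, ← Finset.mul_sum, h]
    ring
  have htI : (t' : ℤ) ∈ I := by rw [hI, Finset.mem_Icc]; omega
  rw [← Finset.add_sum_erase _ _ htI] at L R
  have G : ∑ y ∈ I.erase (t' : ℤ), ∑ A ∈ AA (2 * t') n w,
      (if (y ∈ XA A ∧ y - (2 * t' : ℕ) ∉ XA A) then
      Sg (2 * t') A * Gh (2 * t') (mv (XA A) y (y - (2 * t' : ℕ))) else 0) =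
      - ∑ y ∈ I.erase (t' : ℤ), ∑ B ∈ AA (2 * t') (n - (2 * t' : ℕ)) (w - 2),
      (if (-y ∈ XA B ∧ -y + (2 * t' : ℕ) ∉ XA B) then
      Sg (2 * t') B * Gh (2 * t') (mv (XA B) (-y) (-y + (2 * t' : ℕ))) else 0) := by
    rw [← Finset.sum_neg_distrib]
    exact Finset.sum_congr rfl fun y hy => rec_gen t' htp n w y (Finset.ne_of_mem_erase hy)
  have L1 : ∑ A ∈ AA (2 * t') n w,
      (if ((t' : ℤ) ∈ XA A ∧ (t' : ℤ) - (2 * t' : ℕ) ∉ XA A) then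
      Sg (2 * t') A * Gh (2 * t') (mv (XA A) t' ((t' : ℤ) - (2 * t' : ℕ))) else 0) =
      - ∑ B ∈ (AA (2 * t') (n - t') (w - 1)).filter (fun A => t' ∉ A),
        Sg (2 * t') B * Gh (2 * t') (XA B) := by
    rw [← er_bij t' htp n w (fun B => Sg (2 * t') B * Gh (2 * t') (XA B)),
      ← Finset.sum_neg_distrib, ← Finset.sum_filter]
    refine Finset.sum_congr ?_ ?_
    · refine Finset.filter_congr fun A _ => XA_tp t' htp A
    · intro A hA
      rw [Finset.mem_filter, mem_AA] at hA
      rw [er_Sg t' htp A hA.1.1 hA.2, er_XA t' htp A hA.2]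
      ring
  have R1 : ∑ B ∈ AA (2 * t') (n - (2 * t' : ℕ)) (w - 2),
      (if (-(t' : ℤ) ∈ XA B ∧ -(t' : ℤ) + (2 * t' : ℕ) ∉ XA B) then
      Sg (2 * t') B * Gh (2 * t') (mv (XA B) (-t') (-(t' : ℤ) + (2 * t' : ℕ))) else 0) =
      - ∑ B ∈ (AA (2 * t') (n - t') (w - 1)).filter (fun A => t' ∈ A),
        Sg (2 * t') B * Gh (2 * t') (XA B) := by
    have hb := er_bij t' htp (n - t') (w - 1)
      (fun B => Sg (2 * t') B * Gh (2 * t') (mv (XA B) (-t') (-(t' : ℤ) + (2 * t' : ℕ))))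
    have e1 : n - (t' : ℤ) - t' = n - (2 * t' : ℕ) := by push_cast; ring
    have e2 : w - 1 - 1 = w - 2 := by ring
    rw [e1, e2] at hb
    rw [← Finset.sum_filter]
    rw [Finset.filter_congr (q := fun A => t' ∉ A) (fun A _ => XA_tp' t' htp A), ← hb,
      ← Finset.sum_neg_distrib]
    refine Finset.sum_congr rfl fun A hA => ?_
    rw [Finset.mem_filter, mem_AA] at hA
    rw [er_Sg t' htp A hA.1.1 hA.2, ← er_XA' t' htp A hA.2]
    ring
  have T := Finset.sum_filter_add_sum_filter_not (AA (2 * t') (n - t') (w - 1))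
    (fun A => t' ∈ A) (fun B => Sg (2 * t') B * Gh (2 * t') (XA B))
  rw [L1, G] at L
  rw [R1] at R
  have T' : aa (2 * t') (n - t') (w - 1) = _ := T.symm
  rw [L, R, T']
  ring

def ee (t : ℕ) : ℕ → ℂ
  | 0 => 1
  | 1 => -1
  | (w + 2) => (- ee t (w + 1) - t * ee t w) / (w + 2)

lemma aa_neg (t : ℕ) (n w : ℤ) (h : w < 0) : aa t n w = 0 := by
  rw [aa, Finset.sum_eq_zero]
  intro A hA
  have := (mem_AA.1 hA).2.2
  omega

lemma aa_neg' (t : ℕ) (n w : ℤ) (h : n < 0) : aa t n w = 0 := by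
  rw [aa, Finset.sum_eq_zero]
  intro A hA
  have h1 := (mem_AA.1 hA).2.1
  have : (0 : ℤ) ≤ ∑ a ∈ A, (a : ℤ) := Finset.sum_nonneg (by simp)
  omega

theorem aa_eq (t' : ℕ) (htp : 0 < t') (w : ℕ) : ∀ n : ℤ,
    aa (2 * t') n w = ee (2 * t') w * aa (2 * t') (n - t' * w) 0 := by
  induction w using Nat.strong_induction_on with
  | _ w ih =>
    intro n
    match w, ih with
    | 0, _ => simp [ee]
    | 1, _ =>
      have h := aa_rec t' htp n 1
      rw [aa_neg _ _ (1 - 2) (by norm_num)] at h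
      simpa [ee] using h
    | (w + 2), ih =>
      have h := aa_rec t' htp n ((w + 2 : ℕ) : ℤ)
      have h1 := ih (w + 1) (by omega) (n - t')
      have h2 := ih w (by omega) (n - (2 * t' : ℕ))
      have e1 : ((w + 2 : ℕ) : ℤ) - 1 = (w + 1 : ℕ) := by push_cast; ring
      have e2 : ((w + 2 : ℕ) : ℤ) - 2 = w := by push_cast; ring
      rw [e1, e2, h1, h2] at h
      have e3 : n - (t' : ℤ) - t' * (w + 1 : ℕ) = n - t' * (w + 2 : ℕ) := by push_cast; ring
      have e4 : n - ((2 * t' : ℕ) : ℤ) - t' * w = n - t' * (w + 2 : ℕ) := by push_cast; ring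
      rw [e3, e4] at h
      have h0 : ((w : ℂ) + 2) ≠ 0 := by exact_mod_cast (Nat.succ_ne_zero (w + 1))
      rw [ee]
      push_cast at h ⊢
      field_simp
      linear_combination h

lemma initial_seg (K : Finset ℕ) (h : ∀ k, k + 1 ∈ K → k ∈ K) (k : ℕ) : k ∈ K ↔ k < K.card := by
  have hd : ∀ d k, k + d ∈ K → k ∈ K := by
    intro d
    induction d with
    | zero => intro k hk; exact hk
    | succ d ih => intro k hk; exact ih k (h _ hk)
  constructor
  · intro hk
    have : Finset.range (k + 1) ⊆ K := by
      intro j hj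
      rw [Finset.mem_range] at hj
      exact hd (k - j) j (by rwa [show j + (k - j) = k by omega])
    have := Finset.card_le_card this
    rw [Finset.card_range] at this
    omega
  · intro hk
    by_contra hk'
    have : K ⊆ Finset.range k := by
      intro j hj
      rw [Finset.mem_range]
      by_contra hjk
      exact hk' (hd (j - k) k (by rwa [show k + (j - k) = j by omega]))
    have := Finset.card_le_card this
    rw [Finset.card_range] at this
    omega

/-- number of elements in a residue class -/
def cnt (t : ℕ) (A : Finset ℕ) (ρ : ℕ) : ℕ := (A.filter (fun a => a % t = ρ)).card

def IsCore (t : ℕ) (A : Finset ℕ) : Prop :=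
  (∀ a ∈ A, t < a → a - t ∈ A) ∧ t ∉ A ∧ ∀ a ∈ A, a < t → t - a ∉ A

lemma XA_pos {A : Finset ℕ} {a : ℕ} (h : 0 < a) : (a : ℤ) ∈ XA A ↔ a ∈ A := by
  rw [mem_XA, Int.natAbs_natCast]
  constructor
  · rintro (h | h)
    · exact h.2
    · omega
  · intro h1; exact Or.inl ⟨by omega, h1⟩

lemma core_iff (t : ℕ) (htp : 0 < t) (A : Finset ℕ) (hA : 0 ∉ A) : wt t A = 0 ↔ IsCore t A := by
  have hfin := hooks_finite t (XA_maya' A)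
  rw [wt, Set.ncard_eq_zero hfin]
  have key : hooks t (XA A) = ∅ ↔ ∀ y ∈ XA A, y - t ∈ XA A := by
    constructor
    · intro h y hy
      by_contra hy'
      have : (y, y - (t : ℤ)) ∈ hooks t (XA A) := ⟨hy, hy', by simp; omega, by simp⟩
      rw [h] at this
      exact this
    · intro h
      rw [Set.eq_empty_iff_forall_notMem]
      rintro ⟨y, z⟩ ⟨h1, h2, h3, h4⟩
      simp only at h1 h2 h3 h4
      have hd : (t : ℤ) ∣ y - z := Int.dvd_of_emod_eq_zero (Int.emod_eq_emod_iff_emod_sub_eq_zero.1 h4)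
      obtain ⟨k, hk⟩ := hd
      have hk0 : 0 ≤ k := by
        by_contra hh
        have : (t : ℤ) * k ≤ 0 := by nlinarith
        omega
      obtain ⟨m, rfl⟩ := Int.eq_ofNat_of_zero_le hk0
      have : ∀ m : ℕ, y - t * m ∈ XA A := by
        intro m
        induction m with
        | zero => simpa using h1
        | succ m ih =>
          have := h _ ih
          rwa [show y - (t : ℤ) * (m + 1 : ℕ) = y - t * m - t by push_cast; ring]
      apply h2
      have := this m
      rwa [show z = y - t * m by omega]
  rw [key]
  constructor
  · intro h
    refine ⟨?_, ?_, ?_⟩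
    · intro a ha hta
      have := h a ((XA_pos (by omega)).2 ha)
      rw [show (a : ℤ) - t = (a - t : ℕ) by omega] at this
      exact (XA_pos (by omega)).1 this
    · intro ht
      have := h t ((XA_pos (by omega)).2 ht)
      rw [sub_self] at this
      exact XA_zero this
    · intro a ha hat h2
      have h0 : a ≠ 0 := fun h => hA (h ▸ ha)
      have := h a ((XA_pos (by omega)).2 ha)
      rw [show (a : ℤ) - t = -((t - a : ℕ) : ℤ) by omega, XA_neg (by omega), XA_pos (by omega)] at this
      exact this h2
  · rintro ⟨c1, c2, c3⟩ y hy
    rcases lt_trichotomy y 0 with h0 | h0 | h0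
    · obtain ⟨a, rfl⟩ : ∃ a : ℕ, y = -a := ⟨y.natAbs, by omega⟩
      rw [XA_neg (by omega), XA_pos (by omega)] at hy
      rw [show -(a : ℤ) - t = -((a + t : ℕ) : ℤ) by push_cast; ring, XA_neg (by omega), XA_pos (by omega)]
      intro h
      exact hy (by simpa using c1 _ h (by omega))
    · subst h0; exact absurd hy XA_zero
    · obtain ⟨a, rfl⟩ : ∃ a : ℕ, y = a := ⟨y.natAbs, by omega⟩
      rw [XA_pos (by omega)] at hy
      rcases lt_trichotomy a t with h1 | h1 | h1
      · rw [show (a : ℤ) - t = -((t - a : ℕ) : ℤ) by omega, XA_neg (by omega), XA_pos (by omega)]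
        exact c3 a hy h1
      · subst h1; exact absurd hy c2
      · rw [show (a : ℤ) - t = (a - t : ℕ) by omega, XA_pos (by omega)]
        exact c1 a hy h1

lemma core_mult (t : ℕ) (htp : 0 < t) (A : Finset ℕ) (hA : 0 ∉ A) (h : IsCore t A) :
    ∀ k, t * k ∉ A := by
  intro k
  induction k with
  | zero => simpa using hA
  | succ k ih =>
    intro hk
    rcases Nat.eq_zero_or_pos k with h0 | h0
    · subst h0; exact h.2.1 (by simpa using hk)
    · have : t < t * (k + 1) := by nlinarith
      have := h.1 _ hk this
      rw [mul_add, mul_one, Nat.add_sub_cancel] at this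
      exact ih this

lemma mem_core (t : ℕ) (htp : 0 < t) (A : Finset ℕ) (hA : 0 ∉ A) (h : IsCore t A) (a : ℕ) :
    a ∈ A ↔ a / t < cnt t A (a % t) := by
  set K := (A.filter (fun b => b % t = a % t)).image (fun b => b / t) with hK
  have hcard : K.card = cnt t A (a % t) := by
    rw [hK, Finset.card_image_of_injOn]; · rfl
    intro x hx y hy hxy
    simp only [Finset.coe_filter, Set.mem_ofPred_eq] at hx hy hxy
    rw [← Nat.div_add_mod x t, ← Nat.div_add_mod y t, hxy, hx.2, hy.2]
  have hmem : ∀ k, k ∈ K ↔ t * k + a % t ∈ A := by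
    intro k
    simp only [hK, Finset.mem_image, Finset.mem_filter]
    constructor
    · rintro ⟨b, ⟨h1, h2⟩, rfl⟩
      rwa [← h2, Nat.div_add_mod]
    · intro h1
      refine ⟨_, ⟨h1, ?_⟩, ?_⟩
      · rw [Nat.mul_add_mod, Nat.mod_mod]
      · rw [Nat.mul_add_div htp, Nat.div_eq_of_lt (Nat.mod_lt _ htp), add_zero]
  rw [← hcard, ← initial_seg K ?_, hmem, Nat.div_add_mod]
  intro k hk
  rw [hmem] at hk ⊢
  by_cases hz : t * k + a % t = 0
  · exfalso
    refine core_mult t htp A hA h (k + 1) ?_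
    have : a % t = 0 := by omega
    rwa [this, add_zero] at hk
  · have hm : t * (k + 1) = t * k + t := by ring
    have := h.1 _ hk (by omega)
    rwa [show t * (k + 1) + a % t - t = t * k + a % t by omega] at this

def CC (t r : ℕ) (n : ℤ) : Finset ℕ :=
  (Finset.range n.toNat).image (fun k => t * k + r) ∪
    (Finset.range (-n).toNat).image (fun k => t * k + (t - r))

lemma mem_lin (t ρ m a : ℕ) (hρ : ρ < t) :
    a ∈ (Finset.range m).image (fun k => t * k + ρ) ↔ a % t = ρ ∧ a / t < m := by
  simp only [Finset.mem_image, Finset.mem_range]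
  constructor
  · rintro ⟨k, hk, rfl⟩
    rw [Nat.mul_add_mod, Nat.mul_add_div (by omega), Nat.div_eq_of_lt hρ, add_zero,
      Nat.mod_eq_of_lt hρ]
    exact ⟨rfl, hk⟩
  · rintro ⟨h1, h2⟩
    exact ⟨a / t, h2, by rw [← h1, Nat.div_add_mod]⟩

lemma mem_CC (t r : ℕ) (n : ℤ) (hr : 0 < r) (hrt : r < t) (a : ℕ) :
    a ∈ CC t r n ↔ (a % t = r ∧ a / t < n.toNat) ∨ (a % t = t - r ∧ a / t < (-n).toNat) := by
  rw [CC, Finset.mem_union, mem_lin t r _ a hrt, mem_lin t (t - r) _ a (by omega)]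

def Anu (t' : ℕ) (ν : Fin (t' - 1) → ℤ) : Finset ℕ :=
  Finset.univ.biUnion (fun i : Fin (t' - 1) => CC (2 * t') (i + 1) (ν i))

lemma mem_Anu (t' : ℕ) (ν : Fin (t' - 1) → ℤ) (a : ℕ) :
    a ∈ Anu t' ν ↔ ∃ i : Fin (t' - 1), (a % (2 * t') = i + 1 ∧ a / (2 * t') < (ν i).toNat) ∨
      (a % (2 * t') = 2 * t' - (i + 1) ∧ a / (2 * t') < (-ν i).toNat) := by
  simp only [Anu, Finset.mem_biUnion, Finset.mem_univ, true_and]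
  refine exists_congr fun i => mem_CC _ _ _ (by omega) (by omega) a

lemma Anu_disj (t' : ℕ) (ν : Fin (t' - 1) → ℤ) :
    ((Finset.univ : Finset (Fin (t' - 1))) : Set (Fin (t' - 1))).PairwiseDisjoint
      (fun i => CC (2 * t') (i + 1) (ν i)) := by
  intro i _ j _ hij
  simp only [Function.onFun]
  rw [Finset.disjoint_left]
  intro a h1 h2
  rw [mem_CC _ _ _ (by omega) (by omega)] at h1 h2
  have : (i : ℕ) ≠ j := fun h => hij (Fin.ext h)
  omega

lemma cnt_Anu (t' : ℕ) (ν : Fin (t' - 1) → ℤ) (i : Fin (t' - 1)) :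
    cnt (2 * t') (Anu t' ν) (i + 1) = (ν i).toNat ∧
    cnt (2 * t') (Anu t' ν) (2 * t' - (i + 1)) = (-ν i).toNat := by
  constructor
  · have : (Anu t' ν).filter (fun a => a % (2 * t') = i + 1) =
        (Finset.range (ν i).toNat).image (fun k => 2 * t' * k + (i + 1)) := by
      ext a
      rw [mem_lin _ _ _ _ (by omega), Finset.mem_filter, mem_Anu]
      constructor
      · rintro ⟨⟨j, hj⟩, h2⟩
        have : (j : ℕ) = i := by omega
        have : j = i := Fin.ext this
        subst this
        omega
      · rintro ⟨h1, h2⟩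
        exact ⟨⟨i, Or.inl ⟨h1, h2⟩⟩, h1⟩
    rw [cnt, this, Finset.card_image_of_injective, Finset.card_range]
    intro x y h
    simp only [add_left_inj] at h
    exact Nat.eq_of_mul_eq_mul_left (show 0 < 2 * t' by have := i.isLt; omega) h
  · have : (Anu t' ν).filter (fun a => a % (2 * t') = 2 * t' - (i + 1)) =
        (Finset.range (-ν i).toNat).image (fun k => 2 * t' * k + (2 * t' - (i + 1))) := by
      ext a
      rw [mem_lin _ _ _ _ (by omega), Finset.mem_filter, mem_Anu]
      constructor
      · rintro ⟨⟨j, hj⟩, h2⟩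
        have : (j : ℕ) = i := by omega
        have : j = i := Fin.ext this
        subst this
        omega
      · rintro ⟨h1, h2⟩
        exact ⟨⟨i, Or.inr ⟨h1, h2⟩⟩, h1⟩
    rw [cnt, this, Finset.card_image_of_injective, Finset.card_range]
    intro x y h
    simp only [add_left_inj] at h
    exact Nat.eq_of_mul_eq_mul_left (show 0 < 2 * t' by have := i.isLt; omega) h

lemma Anu_zero (t' : ℕ) (ν : Fin (t' - 1) → ℤ) : 0 ∉ Anu t' ν := by
  rw [mem_Anu]
  rintro ⟨i, h⟩
  simp at h
  omega

lemma Anu_core (t' : ℕ) (htp : 0 < t') (ν : Fin (t' - 1) → ℤ) : IsCore (2 * t') (Anu t' ν) := by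
  refine ⟨?_, ?_, ?_⟩
  · intro a ha hta
    rw [mem_Anu] at ha ⊢
    obtain ⟨i, hi⟩ := ha
    refine ⟨i, ?_⟩
    have e1 : (a - 2 * t') % (2 * t') = a % (2 * t') := (Nat.mod_eq_sub_mod (by omega)).symm
    have e2 : (a - 2 * t') / (2 * t') ≤ a / (2 * t') := Nat.div_le_div_right (by omega)
    omega
  · rw [mem_Anu]
    rintro ⟨i, h⟩
    simp at h
    omega
  · intro a ha hta h2
    rw [mem_Anu] at ha h2
    obtain ⟨i, hi⟩ := ha
    obtain ⟨j, hj⟩ := h2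
    have h0 : a ≠ 0 := by
      rintro rfl
      simp at hi
      omega
    rw [Nat.mod_eq_of_lt hta, Nat.div_eq_of_lt hta] at hi
    rw [Nat.mod_eq_of_lt (by omega), Nat.div_eq_of_lt (by omega)] at hj
    have : (i : ℕ) = j := by omega
    have : i = j := Fin.ext this
    subst this
    omega

def nuA (t' : ℕ) (A : Finset ℕ) : Fin (t' - 1) → ℤ := fun i =>
  (cnt (2 * t') A (i + 1) : ℤ) - cnt (2 * t') A (2 * t' - (i + 1))

lemma nuA_Anu (t' : ℕ) (ν : Fin (t' - 1) → ℤ) : nuA t' (Anu t' ν) = ν := by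
  ext i
  rw [nuA, (cnt_Anu t' ν i).1, (cnt_Anu t' ν i).2]
  omega

lemma Anu_nuA (t' : ℕ) (htp : 0 < t') (A : Finset ℕ) (hA : 0 ∉ A) (h : IsCore (2 * t') A) :
    Anu t' (nuA t' A) = A := by
  have hmem := mem_core (2 * t') (by omega) A hA h
  have c0 : cnt (2 * t') A 0 = 0 := by
    have := hmem 0
    simp [hA] at this
    exact this
  have cρ : ∀ ρ, 0 < ρ → ρ < 2 * t' → cnt (2 * t') A ρ = 0 ∨ cnt (2 * t') A (2 * t' - ρ) = 0 := by
    intro ρ h1 h2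
    by_contra hc
    push Not at hc
    have h3 := hmem ρ
    rw [Nat.div_eq_of_lt h2, Nat.mod_eq_of_lt h2] at h3
    have h4 := hmem (2 * t' - ρ)
    rw [Nat.div_eq_of_lt (by omega), Nat.mod_eq_of_lt (by omega)] at h4
    exact h.2.2 ρ (h3.2 (by omega)) h2 (h4.2 (by omega))
  have ct : cnt (2 * t') A t' = 0 := by
    have := cρ t' htp (by omega)
    rw [show 2 * t' - t' = t' by omega] at this
    tauto
  ext a
  rw [mem_Anu, hmem]
  constructor
  · rintro ⟨i, hi⟩
    have h1 := cρ (i + 1) (by omega) (by omega)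
    simp only [nuA] at hi
    rcases hi with ⟨h2, h3⟩ | ⟨h2, h3⟩ <;> rw [h2] <;> omega
  · intro ha
    have hlt := Nat.mod_lt a (show 0 < 2 * t' by omega)
    rcases Nat.lt_trichotomy (a % (2 * t')) t' with h1 | h1 | h1
    · have h0 : a % (2 * t') ≠ 0 := by
        intro h; rw [h, c0] at ha; exact absurd ha (Nat.not_lt_zero _)
      refine ⟨⟨a % (2 * t') - 1, by omega⟩, Or.inl ⟨by simp; omega, ?_⟩⟩
      have h2 := cρ (a % (2 * t')) (by omega) hlt
      simp only [nuA]
      rw [show a % (2 * t') - 1 + 1 = a % (2 * t') by omega]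
      omega
    · rw [h1, ct] at ha; exact absurd ha (Nat.not_lt_zero _)
    · refine ⟨⟨2 * t' - a % (2 * t') - 1, by omega⟩, Or.inr ⟨by simp; omega, ?_⟩⟩
      have h2 := cρ (a % (2 * t')) (by omega) hlt
      simp only [nuA]
      rw [show 2 * t' - a % (2 * t') - 1 + 1 = 2 * t' - a % (2 * t') by omega,
        show 2 * t' - (2 * t' - a % (2 * t')) = a % (2 * t') by omega]
      omega

def Theta (t r m : ℕ) : PowerSeries ℂ :=
  ∑ n ∈ Finset.Icc (-(m : ℤ)) m, C ((-1 : ℂ) ^ (CC t r n).card) * X ^ (∑ a ∈ CC t r n, a)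

theorem core_coeff (t' : ℕ) (htp : 0 < t') (m N : ℕ) (hN : N ≤ m) :
    coeff N (∏ i : Fin (t' - 1), Theta (2 * t') (i + 1) m) = aa (2 * t') N 0 := by
  simp only [Theta]
  rw [Finset.prod_univ_sum]
  have e1 : ∀ ν : Fin (t' - 1) → ℤ, ∏ i : Fin (t' - 1), (C ((-1 : ℂ) ^ (CC (2 * t') (i + 1) (ν i)).card) *
      X ^ (∑ a ∈ CC (2 * t') (i + 1) (ν i), a) : PowerSeries ℂ) =
      C ((-1 : ℂ) ^ (Anu t' ν).card) * X ^ (∑ a ∈ Anu t' ν, a) := by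
    intro ν
    rw [Finset.prod_mul_distrib, Finset.prod_pow_eq_pow_sum, ← map_prod, Finset.prod_pow_eq_pow_sum,
      Anu, Finset.card_biUnion (Anu_disj t' ν), Finset.sum_biUnion (Anu_disj t' ν)]
  simp only [e1]
  rw [map_sum]
  simp only [coeff_C_mul, coeff_X_pow]
  rw [aa]
  simp only [mul_ite, mul_one, mul_zero]
  rw [← Finset.sum_filter]
  refine Finset.sum_nbij' (Anu t') (nuA t') ?_ ?_ ?_ ?_ ?_
  · intro ν hν
    rw [Finset.mem_filter] at hν
    rw [mem_AA]
    refine ⟨Anu_zero t' ν, ?_, ?_⟩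
    · rw [hν.2, Nat.cast_sum]
    · exact_mod_cast (core_iff _ (by omega) _ (Anu_zero t' ν)).2 (Anu_core t' htp ν)
  · intro A hA
    rw [mem_AA] at hA
    have hc : IsCore (2 * t') A := (core_iff _ (by omega) _ hA.1).1 (by exact_mod_cast hA.2.2)
    have hs : ∑ a ∈ A, a = N := by
      have := hA.2.1
      rw [← Nat.cast_sum] at this
      exact Int.ofNat_inj.1 this
    rw [Finset.mem_filter, Anu_nuA t' htp A hA.1 hc, Fintype.mem_piFinset]
    refine ⟨fun i => ?_, hs.symm⟩
    have hcard : A.card ≤ N := by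
      rw [← hs, Finset.card_eq_sum_ones]
      refine Finset.sum_le_sum fun a ha => ?_
      have : a ≠ 0 := fun h => hA.1 (h ▸ ha)
      omega
    have h1 : cnt (2 * t') A (i + 1) ≤ A.card := Finset.card_filter_le _ _
    have h2 : cnt (2 * t') A (2 * t' - (i + 1)) ≤ A.card := Finset.card_filter_le _ _
    rw [Finset.mem_Icc, nuA]
    omega
  · intro ν _; exact nuA_Anu t' ν
  · intro A hA
    rw [mem_AA] at hA
    exact Anu_nuA t' htp A hA.1 ((core_iff _ (by omega) _ hA.1).1 (by exact_mod_cast hA.2.2))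
  · intro ν hν
    have hw : wt (2 * t') (Anu t' ν) = 0 :=
      (core_iff _ (by omega) _ (Anu_zero t' ν)).2 (Anu_core t' htp ν)
    have hh : hooks (2 * t') (XA (Anu t' ν)) = ∅ :=
      (Set.ncard_eq_zero (hooks_finite _ (XA_maya' _))).1 hw
    have hG : Gh (2 * t') (XA (Anu t' ν)) = 1 := by
      rw [Gh, hh]; simp
    have hNn : Nn (2 * t') (Anu t' ν) = 0 := by
      rw [Nn, hh]; simp
    rw [hG, Sg, hNn, mul_one, add_zero]

/-- Gaussian binomials -/
def gb {R : Type*} [CommRing R] (q : R) : ℕ → ℕ → R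
  | _, 0 => 1
  | 0, _ + 1 => 0
  | n + 1, k + 1 => gb q n k + q ^ (k + 1) * gb q n (k + 1)

lemma gb_zero {R : Type*} [CommRing R] (q : R) (n : ℕ) : gb q n 0 = 1 := by
  cases n <;> rfl

lemma gb_big {R : Type*} [CommRing R] (q : R) : ∀ n k : ℕ, n < k → gb q n k = 0 := by
  intro n
  induction n with
  | zero => intro k hk; obtain ⟨k, rfl⟩ : ∃ l, k = l + 1 := ⟨k - 1, by omega⟩; rfl
  | succ n ih =>
    intro k hk
    obtain ⟨k, rfl⟩ : ∃ l, k = l + 1 := ⟨k - 1, by omega⟩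
    rw [gb, ih k (by omega), ih (k + 1) (by omega)]; ring

def tri (j : ℕ) : ℕ := ∑ i ∈ Finset.range j, i

lemma tri_succ (j : ℕ) : tri (j + 1) = tri j + j := by
  rw [tri, Finset.sum_range_succ]; rfl

lemma tri_two (j : ℕ) : (2 : ℤ) * tri j = j * (j - 1) := by
  induction j with
  | zero => simp [tri]
  | succ j ih => rw [tri_succ]; push_cast; linarith

theorem qbinom {R : Type*} [CommRing R] (q a : R) (N : ℕ) : ∀ b : R,
    ∏ k ∈ Finset.range N, (a - b * q ^ k) =
      ∑ j ∈ Finset.range (N + 1), (-1) ^ j * q ^ tri j * a ^ (N - j) * b ^ j * gb q N j := by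
  induction N with
  | zero => intro b; simp [gb, tri]
  | succ N ih =>
    intro b
    rw [Finset.prod_range_succ']
    have h := ih (b * q)
    have e : ∏ k ∈ Finset.range N, (a - b * q ^ (k + 1)) =
        ∏ k ∈ Finset.range N, (a - b * q * q ^ k) :=
      Finset.prod_congr rfl fun k _ => by ring
    rw [e, h, pow_zero, mul_one, Finset.sum_range_succ' _ (N + 1)]
    rw [mul_sub, Finset.sum_mul, Finset.sum_mul]
    have f1 : ∑ j ∈ Finset.range (N + 1), (-1) ^ (j + 1) * q ^ tri (j + 1) * a ^ (N + 1 - (j + 1)) *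
        b ^ (j + 1) * gb q (N + 1) (j + 1) =
        ∑ j ∈ Finset.range (N + 1), (-1) ^ (j + 1) * q ^ tri (j + 1) * a ^ (N + 1 - (j + 1)) *
        b ^ (j + 1) * (q ^ (j + 1) * gb q N (j + 1)) -
        ∑ j ∈ Finset.range (N + 1), (-1) ^ j * q ^ tri j * a ^ (N - j) * (b * q) ^ j * gb q N j * b := by
      rw [← Finset.sum_sub_distrib]
      refine Finset.sum_congr rfl fun j hj => ?_
      rw [gb, tri_succ, Nat.add_sub_add_right]
      ring
    rw [f1]
    have f2 : ∑ j ∈ Finset.range (N + 1), (-1) ^ j * q ^ tri j * a ^ (N - j) * (b * q) ^ j * gb q N j * a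
        = ∑ j ∈ Finset.range (N + 1), (-1) ^ (j + 1) * q ^ tri (j + 1) * a ^ (N + 1 - (j + 1)) *
        b ^ (j + 1) * (q ^ (j + 1) * gb q N (j + 1)) + a ^ (N + 1) := by
      rw [Finset.sum_range_succ', Finset.sum_range_succ _ N, gb_big q N (N + 1) (by omega)]
      simp only [gb_zero, mul_zero, add_zero]
      congr 1
      · refine Finset.sum_congr rfl fun j hj => ?_
        rw [Finset.mem_range] at hj
        have : N + 1 - (j + 1) = (N - (j + 1)) + 1 := by omega
        rw [this]
        ring
      · simp [tri]; ring
    rw [f2]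
    simp [tri, gb_zero]
    ring

def qp {R : Type*} [CommRing R] (q : R) (n : ℕ) : R := ∏ i ∈ Finset.range n, (1 - q ^ (i + 1))

lemma qp_succ {R : Type*} [CommRing R] (q : R) (n : ℕ) : qp q (n + 1) = qp q n * (1 - q ^ (n + 1)) := by
  rw [qp, Finset.prod_range_succ]; rfl

lemma gb_qp {R : Type*} [CommRing R] (q : R) (n : ℕ) : ∀ k ≤ n,
    gb q n k * (qp q k * qp q (n - k)) = qp q n := by
  induction n with
  | zero => intro k hk; obtain rfl : k = 0 := by omega
            simp [gb, qp]
  | succ n ih =>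
    intro k hk
    rcases k with _ | k
    · simp [gb_zero, qp]
    · rw [gb, Nat.add_sub_add_right]
      have h1 := ih k (by omega)
      rcases Nat.lt_or_ge n (k + 1) with h | h
      · obtain rfl : k = n := by omega
        rw [gb_big q k (k + 1) (by omega), mul_zero, add_zero, qp_succ]
        linear_combination (1 - q ^ (k + 1)) * h1
      · have h2 := ih (k + 1) h
        have e : n - k = (n - (k + 1)) + 1 := by omega
        have e2 : qp q (n - k) = qp q (n - (k + 1)) * (1 - q ^ (n - k)) := by
          rw [e, qp_succ]
        have e3 : q ^ (n + 1) = q ^ (k + 1) * q ^ (n - k) := by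
          rw [← pow_add]; congr 1; omega
        rw [add_mul, qp_succ q n, e3]
        have : gb q n k * (qp q (k + 1) * qp q (n - k)) = qp q n * (1 - q ^ (k + 1)) := by
          rw [← h1, qp_succ]; ring
        rw [this]
        have : q ^ (k + 1) * gb q n (k + 1) * (qp q (k + 1) * qp q (n - k)) =
          q ^ (k + 1) * (1 - q ^ (n - k)) * qp q n := by
          rw [← h2, e2]; ring
        rw [this]
        ring

lemma CC_pos (t r : ℕ) (p : ℕ) : CC t r p = (Finset.range p).image (fun k => t * k + r) := by
  simp [CC]

lemma CC_neg (t r : ℕ) (p : ℕ) : CC t r (-p) = (Finset.range p).image (fun k => t * k + (t - r)) := by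
  simp [CC]

lemma lin_inj (t r : ℕ) (ht : 0 < t) : Function.Injective (fun k => t * k + r) := by
  intro x y h
  simp only [add_left_inj] at h
  exact Nat.eq_of_mul_eq_mul_left ht h

lemma CC_card (t r : ℕ) (ht : 0 < t) (n : ℤ) : (CC t r n).card = n.natAbs := by
  obtain ⟨p, rfl | rfl⟩ := n.eq_nat_or_neg
  · rw [CC_pos, Finset.card_image_of_injective _ (lin_inj t r ht)]; simp
  · rw [CC_neg, Finset.card_image_of_injective _ (lin_inj t (t - r) ht)]; simp

lemma CC_sum (t r : ℕ) (hr : 0 < r) (hrt : r < t) (n : ℤ) :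
    2 * (((∑ a ∈ CC t r n, a : ℕ)) : ℤ) = 2 * r * n + t * (n * (n - 1)) := by
  have ht : 0 < t := by omega
  have aux : ∀ (s p : ℕ), 2 * (((∑ a ∈ (Finset.range p).image (fun k => t * k + s), a : ℕ)) : ℤ)
      = 2 * s * p + t * (p * (p - 1)) := by
    intro s p
    rw [Finset.sum_image (by intro x _ y _ h; exact lin_inj t s ht h), Finset.sum_add_distrib,
      ← Finset.mul_sum]
    have := tri_two p
    rw [← this, tri]
    simp
    ring
  obtain ⟨p, rfl | rfl⟩ := n.eq_nat_or_neg
  · rw [CC_pos, aux]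
  · rw [CC_neg, aux]
    push_cast [Nat.cast_sub hrt.le]
    ring

lemma CC_sum_ge (t r : ℕ) (hr : 0 < r) (hrt : r < t) (n : ℤ) : n.natAbs ≤ ∑ a ∈ CC t r n, a := by
  rw [← CC_card t r (by omega) n, Finset.card_eq_sum_ones]
  refine Finset.sum_le_sum fun a ha => ?_
  rw [mem_CC t r n hr hrt] at ha
  rcases Nat.eq_zero_or_pos a with h | h
  · subst h
    simp at ha
    omega
  · exact h

def PP (t r m : ℕ) : PowerSeries ℂ :=
  ∏ k ∈ Finset.range m, ((1 - X ^ (t * k + r)) * (1 - X ^ (t * k + (t - r))))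

theorem finite_jtp (t r m : ℕ) (hr : 0 < r) (hrt : r < t) :
    PP t r m = ∑ n ∈ Finset.Icc (-(m : ℤ)) m,
      C ((-1 : ℂ) ^ (CC t r n).card) * X ^ (∑ a ∈ CC t r n, a) *
        gb (X ^ t : PowerSeries ℂ) (2 * m) (n + m).toNat := by
  set q : PowerSeries ℂ := X ^ t with hq
  have h := qbinom q (X ^ (t * m) : PowerSeries ℂ) (2 * m) (X ^ r)
  obtain ⟨B, hB⟩ : ∃ B : ℕ, B = ∑ k ∈ Finset.range m, (t * k + r) + t * m * m := ⟨_, rfl⟩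
  have hB2 : (2 : ℤ) * B = t * (m * (m - 1)) + 2 * r * m + 2 * (t * m * m) := by
    have := tri_two m
    rw [hB, Finset.sum_add_distrib, ← Finset.mul_sum, ← this, tri]
    simp
    ring
  have L : ∏ k ∈ Finset.range (2 * m), ((X ^ (t * m) : PowerSeries ℂ) - X ^ r * q ^ k) =
      (-1) ^ m * X ^ B * PP t r m := by
    rw [two_mul, Finset.prod_range_add, ← Finset.prod_range_reflect]
    have e1 : ∀ k ∈ Finset.range m, ((X ^ (t * m) : PowerSeries ℂ) - X ^ r * q ^ (m - 1 - k)) =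
        (-1) * X ^ (t * (m - 1 - k) + r) * (1 - X ^ (t * k + (t - r))) := by
      intro k hk
      rw [Finset.mem_range] at hk
      have : t * m = (t * (m - 1 - k) + r) + (t * k + (t - r)) := by
        have : m = (m - 1 - k) + k + 1 := by omega
        have e : t * m = t * (m - 1 - k) + t * k + t := by
          conv_lhs => rw [this]
          ring
        omega
      rw [this, hq]
      ring
    have e2 : ∀ k ∈ Finset.range m, ((X ^ (t * m) : PowerSeries ℂ) - X ^ r * q ^ (m + k)) =
        X ^ (t * m) * (1 - X ^ (t * k + r)) := by
      intro k hk
      rw [hq]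
      ring
    rw [Finset.prod_congr rfl e1, Finset.prod_congr rfl e2, PP]
    simp only [Finset.prod_mul_distrib]
    rw [Finset.prod_range_reflect (fun k => (X ^ (t * k + r) : PowerSeries ℂ)) m,
      Finset.prod_pow_eq_pow_sum, hB, pow_add]
    simp
    ring
  have R : ∑ j ∈ Finset.range (2 * m + 1), (-1) ^ j * q ^ tri j * (X ^ (t * m)) ^ (2 * m - j) *
      (X ^ r) ^ j * gb q (2 * m) j =
      (-1) ^ m * X ^ B * ∑ n ∈ Finset.Icc (-(m : ℤ)) m,
      C ((-1 : ℂ) ^ (CC t r n).card) * X ^ (∑ a ∈ CC t r n, a) * gb q (2 * m) (n + m).toNat := by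
    rw [Finset.mul_sum]
    refine Finset.sum_nbij' (fun j => (j : ℤ) - m) (fun n => (n + m).toNat) ?_ ?_ ?_ ?_ ?_
    · intro j hj
      rw [Finset.mem_range] at hj
      rw [Finset.mem_Icc]; omega
    · intro n hn
      rw [Finset.mem_Icc] at hn
      rw [Finset.mem_range]; omega
    · intro j _; simp
    · intro n hn
      rw [Finset.mem_Icc] at hn
      omega
    · intro j hj
      rw [Finset.mem_range] at hj
      rw [show ((j : ℤ) - m + m).toNat = j by omega]
      have hs : ((-1 : PowerSeries ℂ)) ^ j = (-1) ^ m * C ((-1 : ℂ) ^ (CC t r ((j : ℤ) - m)).card) := by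
        rw [CC_card t r (by omega), map_pow, map_neg, map_one, ← pow_add]
        rcases Nat.even_or_odd j with h1 | h1
        · have h2 : Even (m + ((j : ℤ) - m).natAbs) := by
            rw [Nat.even_iff] at h1 ⊢; omega
          rw [h1.neg_one_pow, h2.neg_one_pow]
        · have h2 : Odd (m + ((j : ℤ) - m).natAbs) := by
            rw [Nat.odd_iff] at h1 ⊢; omega
          rw [h1.neg_one_pow, h2.neg_one_pow]
      have he : t * tri j + t * m * (2 * m - j) + r * j = B + ∑ a ∈ CC t r ((j : ℤ) - m), a := by
        have h1 := CC_sum t r hr hrt ((j : ℤ) - m)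
        have h2 := tri_two j
        have h3 : ((2 * m - j : ℕ) : ℤ) = 2 * m - j := by omega
        zify
        rw [h3]
        push_cast at h1
        have h4 : (t : ℤ) * (2 * tri j) = t * (j * (j - 1)) := by rw [h2]
        nlinarith
      have hx : q ^ tri j * (X ^ (t * m)) ^ (2 * m - j) * (X ^ r) ^ j =
          (X ^ B * X ^ (∑ a ∈ CC t r ((j : ℤ) - m), a) : PowerSeries ℂ) := by
        rw [hq, ← pow_mul, ← pow_mul, ← pow_mul, ← pow_add, ← pow_add, ← pow_add, he]
      rw [hs]
      linear_combination (gb q (2 * m) j * (-1) ^ m * C ((-1 : ℂ) ^ (CC t r ((j : ℤ) - m)).card)) * hx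
  rw [L, R] at h
  refine mul_left_cancel₀ ?_ h
  refine mul_ne_zero (pow_ne_zero _ (by simp)) (pow_ne_zero _ X_ne_zero)

/-- Jacobi triple product modulo `X^K` -/
theorem jtp_mod {Q : Type*} [CommRing Q] (φ : PowerSeries ℂ →+* Q) (K : ℕ) (hφ : φ X ^ K = 0)
    (hu : ∀ f : PowerSeries ℂ, constantCoeff f = 1 → IsUnit (φ f))
    (t r m : ℕ) (hr : 0 < r) (hrt : r < t) (hm : 2 * K ≤ m) :
    φ (qp (X ^ t) m) * φ (PP t r m) = φ (Theta t r m) := by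
  have hz : ∀ i, K ≤ i → φ X ^ i = 0 := by
    intro i hi
    rw [show i = K + (i - K) by omega, pow_add, hφ, zero_mul]
  have hqp : ∀ i, K ≤ i → φ (qp (X ^ t) i) = φ (qp (X ^ t) K) := by
    intro i hi
    induction i, hi using Nat.le_induction with
    | base => rfl
    | succ i hi ih =>
      rw [qp_succ, map_mul, ih, map_sub, map_one, map_pow, map_pow, ← pow_mul,
        hz (t * (i + 1)) (by nlinarith), sub_zero, mul_one]
  rw [finite_jtp t r m hr hrt, Theta, map_sum, map_sum, Finset.mul_sum]
  refine Finset.sum_congr rfl fun n hn => ?_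
  rw [Finset.mem_Icc] at hn
  rw [map_mul, map_mul]
  by_cases hnK : n.natAbs + K ≤ m
  · have h := congrArg φ (gb_qp (X ^ t : PowerSeries ℂ) (2 * m) (n + m).toNat (by omega))
    rw [map_mul, map_mul, hqp _ (show K ≤ (n + m).toNat by omega),
      hqp _ (show K ≤ 2 * m - (n + m).toNat by omega), hqp _ (show K ≤ 2 * m by omega)] at h
    have hU : IsUnit (φ (qp (X ^ t) K)) := by
      apply hu
      rw [qp, map_prod]
      refine Finset.prod_eq_one fun i _ => ?_
      have : t * (i + 1) ≠ 0 := Nat.mul_ne_zero (by omega) (by omega)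
      rw [map_sub, map_pow, map_pow, constantCoeff_X, ← pow_mul, zero_pow this]
      simp
    have h2 : φ (qp (X ^ t) K) * φ (gb (X ^ t) (2 * m) (n + m).toNat) = 1 := by
      refine hU.mul_left_cancel ?_
      rw [mul_one]
      linear_combination h
    rw [hqp m (by omega)]
    linear_combination (φ (C ((-1 : ℂ) ^ (CC t r n).card)) * φ (X ^ (∑ a ∈ CC t r n, a))) * h2
  · have : φ (X ^ (∑ a ∈ CC t r n, a)) = 0 := by
      rw [map_pow]
      refine hz _ ?_
      have := CC_sum_ge t r hr hrt n
      omega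
    rw [this]
    ring

lemma PP_block (t' : ℕ) (htp : 0 < t') (f : ℕ → PowerSeries ℂ) :
    ∏ j ∈ Finset.range (2 * t'), f (j + 1) =
      (∏ i : Fin (t' - 1), (f (i + 1) * f (2 * t' - (i + 1)))) * (f t' * f (2 * t')) := by
  obtain ⟨s, rfl⟩ : ∃ s, t' = s + 1 := ⟨t' - 1, by omega⟩
  rw [show s + 1 - 1 = s from rfl,
    Fin.prod_univ_eq_prod_range (fun i => f (i + 1) * f (2 * (s + 1) - (i + 1))) s,
    show 2 * (s + 1) = s + 1 + s + 1 by ring, Finset.prod_range_succ, Finset.prod_range_add,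
    Finset.prod_range_succ, Finset.prod_mul_distrib,
    ← Finset.prod_range_reflect (fun x => f (s + 1 + x + 1)) s]
  have : ∏ j ∈ Finset.range s, f (s + 1 + (s - 1 - j) + 1) =
      ∏ x ∈ Finset.range s, f (s + 1 + s + 1 - (x + 1)) := by
    refine Finset.prod_congr rfl fun j hj => ?_
    rw [Finset.mem_range] at hj
    congr 1
    omega
  rw [this]
  ring

lemma PP_prod (t' : ℕ) (htp : 0 < t') (m : ℕ) :
    (∏ i : Fin (t' - 1), PP (2 * t') (i + 1) m) * qp (X ^ t') (2 * m) =
      qp (X : PowerSeries ℂ) (2 * t' * m) := by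
  induction m with
  | zero => simp [PP, qp]
  | succ m ih =>
    have e1 : ∀ i : Fin (t' - 1), PP (2 * t') (i + 1) (m + 1) = PP (2 * t') (i + 1) m *
        ((1 - X ^ (2 * t' * m + (i + 1))) * (1 - X ^ (2 * t' * m + (2 * t' - (i + 1))))) := by
      intro i
      rw [PP, Finset.prod_range_succ]; rfl
    simp only [e1]
    rw [Finset.prod_mul_distrib, mul_add, mul_one, qp_succ, qp_succ, mul_add, mul_one]
    have e2 : qp (X : PowerSeries ℂ) (2 * t' * m + 2 * t') = qp X (2 * t' * m) *
        ∏ j ∈ Finset.range (2 * t'), (1 - X ^ (2 * t' * m + (j + 1))) := by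
      rw [qp, Finset.prod_range_add]; rfl
    rw [e2, PP_block t' htp (fun j => 1 - X ^ (2 * t' * m + j)), ← ih, ← pow_mul, ← pow_mul]
    rw [show t' * (2 * m + 1) = 2 * t' * m + t' by ring,
      show t' * (2 * m + 1 + 1) = 2 * t' * m + 2 * t' by ring]
    ring

def FF (t' k : ℕ) : PowerSeries ℂ := (1 - X ^ (k + 1)) * (1 - X ^ ((k + 1) * (2 * t'))) ^ (t' - 1) *
          (1 - X ^ ((k + 1) * t') : PowerSeries ℂ)⁻¹

lemma cc_one (n : ℕ) (h : n ≠ 0) : constantCoeff (1 - X ^ n : PowerSeries ℂ) = 1 := by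
  rw [map_sub, map_pow, constantCoeff_X, zero_pow h]; simp

lemma FF_prod (t' : ℕ) (htp : 0 < t') (M : ℕ) :
    (∏ k ∈ Finset.range M, FF t' k) * qp (X ^ t') M = qp X M * qp (X ^ (2 * t')) M ^ (t' - 1) := by
  simp only [qp, ← Finset.prod_pow, ← Finset.prod_mul_distrib]
  refine Finset.prod_congr rfl fun k _ => ?_
  have : (1 - X ^ ((k + 1) * t') : PowerSeries ℂ)⁻¹ * (1 - X ^ ((k + 1) * t')) = 1 := by
    apply PowerSeries.inv_mul_cancel
    rw [cc_one _ (Nat.mul_ne_zero (by omega) (by omega))]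
    exact one_ne_zero
  rw [FF, mul_assoc, ← pow_mul, ← pow_mul, mul_comm t' (k + 1), mul_comm (2 * t') (k + 1), this,
    mul_one]

lemma unit_map {Q : Type*} [CommRing Q] (φ : PowerSeries ℂ →+* Q) (f : PowerSeries ℂ)
    (h : constantCoeff f = 1) : IsUnit (φ f) := by
  refine IsUnit.map φ ?_
  rw [PowerSeries.isUnit_iff_constantCoeff, h]
  exact isUnit_one

lemma FF_mod {Q : Type*} [CommRing Q] (φ : PowerSeries ℂ →+* Q) (K : ℕ) (hφ : φ X ^ K = 0)
    (t' : ℕ) (htp : 0 < t') (s : Finset ℕ) (hs : Finset.range K ⊆ s) (m : ℕ) (hm : 2 * K ≤ m) :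
    φ (∏ k ∈ s, FF t' k) = φ (∏ i : Fin (t' - 1), Theta (2 * t') (i + 1) m) := by
  have hz : ∀ i, K ≤ i → φ X ^ i = 0 := by
    intro i hi
    rw [show i = K + (i - K) by omega, pow_add, hφ, zero_mul]
  have hqp : ∀ u, 0 < u → ∀ i, K ≤ i → φ (qp (X ^ u) i) = φ (qp (X ^ u) K) := by
    intro u hu i hi
    induction i, hi using Nat.le_induction with
    | base => rfl
    | succ i hi ih =>
      rw [qp_succ, map_mul, ih, map_sub, map_one, map_pow, map_pow, ← pow_mul,
        hz (u * (i + 1)) (by nlinarith), sub_zero, mul_one]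
  have hs1 : φ (∏ k ∈ s, FF t' k) = φ (∏ k ∈ Finset.range K, FF t' k) := by
    rw [← Finset.prod_sdiff hs, map_mul]
    have : φ (∏ k ∈ s \ Finset.range K, FF t' k) = 1 := by
      rw [map_prod]
      refine Finset.prod_eq_one fun k hk => ?_
      rw [Finset.mem_sdiff, Finset.mem_range] at hk
      have h1 : ∀ u, 0 < u → φ (1 - X ^ ((k + 1) * u)) = 1 := by
        intro u hu
        rw [map_sub, map_one, map_pow, hz _ (by nlinarith), sub_zero]
      have h2 : φ ((1 - X ^ ((k + 1) * t') : PowerSeries ℂ)⁻¹) = 1 := by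
        have : (1 - X ^ ((k + 1) * t') : PowerSeries ℂ)⁻¹ * (1 - X ^ ((k + 1) * t')) = 1 := by
          apply PowerSeries.inv_mul_cancel
          rw [cc_one _ (Nat.mul_ne_zero (by omega) (by omega))]
          exact one_ne_zero
        have := congrArg φ this
        rwa [map_mul, h1 t' htp, mul_one, map_one] at this
      have h3 := h1 1 one_pos
      rw [mul_one] at h3
      rw [FF, map_mul, map_mul, map_pow, h2, h3, h1 _ (by omega)]
      simp
    rw [this, one_mul]
  rw [hs1]
  have hT : φ (∏ i : Fin (t' - 1), Theta (2 * t') (i + 1) m) =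
      φ (qp (X ^ (2 * t')) K) ^ (t' - 1) * φ (∏ i : Fin (t' - 1), PP (2 * t') (i + 1) m) := by
    rw [map_prod, map_prod]
    have : ∀ i : Fin (t' - 1), φ (Theta (2 * t') (i + 1) m) =
        φ (qp (X ^ (2 * t')) K) * φ (PP (2 * t') (i + 1) m) := by
      intro i
      rw [← jtp_mod φ K hφ (fun f hf => unit_map φ f hf) (2 * t') (i + 1) m (by omega) (by omega) hm,
        hqp _ (by omega) m (by omega)]
    simp only [this]
    rw [Finset.prod_mul_distrib]
    simp
  have hU : IsUnit (φ (qp (X ^ t') K)) := by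
    apply unit_map
    rw [qp, map_prod]
    refine Finset.prod_eq_one fun i _ => ?_
    rw [← pow_mul]
    exact cc_one _ (Nat.mul_ne_zero (by omega) (by omega))
  refine hU.mul_right_cancel ?_
  rw [← map_mul, FF_prod t' htp K, hT]
  have h1 := congrArg φ (PP_prod t' htp m)
  rw [map_mul, hqp t' htp (2 * m) (by omega)] at h1
  have h2 := hqp 1 one_pos (2 * t' * m) (by nlinarith)
  rw [pow_one] at h2
  rw [mul_assoc, h1, h2, map_mul, map_pow]
  ring

theorem FF_coeff (t' : ℕ) (htp : 0 < t') (N : ℕ) (s : Finset ℕ) (hs : Finset.range (N + 1) ⊆ s) :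
    coeff N (∏ k ∈ s, FF t' k) = aa (2 * t') N 0 := by
  rw [← core_coeff t' htp (2 * (N + 1)) N (by omega)]
  have h := FF_mod (Ideal.Quotient.mk (Ideal.span {(X : PowerSeries ℂ) ^ (N + 1)})) (N + 1)
    (by rw [← map_pow, Ideal.Quotient.eq_zero_iff_mem]; exact Ideal.subset_span rfl)
    t' htp s hs (2 * (N + 1)) le_rfl
  rw [Ideal.Quotient.eq, Ideal.mem_span_singleton, PowerSeries.X_pow_dvd_iff] at h
  have := h N (by omega)
  rw [map_sub, sub_eq_zero] at this
  exact this

lemma ps_tendsto {ι : Type*} (l : Filter ι) (f : ι → PowerSeries ℂ) (g : PowerSeries ℂ)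
    (h : ∀ n, ∀ᶠ i in l, coeff n (f i) = coeff n g) : Filter.Tendsto f l (nhds g) := by
  refine (PowerSeries.WithPiTopology.tendsto_iff_coeff_tendsto ℂ f l g).2 fun n => ?_
  exact tendsto_nhds_of_eventually_eq (h n)

lemma ps_t2 : T2Space (PowerSeries ℂ) := PowerSeries.WithPiTopology.instT2Space ℂ

theorem FF_tprod (t' : ℕ) (htp : 0 < t') :
    ∏' k, FF t' k = PowerSeries.mk (fun n => aa (2 * t') n 0) := by
  have := ps_t2
  refine HasProd.tprod_eq ?_
  refine ps_tendsto _ _ _ fun n => ?_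
  filter_upwards [Filter.eventually_ge_atTop (Finset.range (n + 1))] with s hs
  rw [FF_coeff t' htp n s hs, coeff_mk]

def EE (t' : ℕ) (b : ℂ) : PowerSeries ℂ :=
  PowerSeries.mk fun n => if t' ∣ n then ee (2 * t') (n / t') * b ^ (n / t') else 0

def ff (t' : ℕ) (b : ℂ) : PowerSeries ℂ :=
  - (PowerSeries.C (R := ℂ) b * X ^ t') -
        PowerSeries.C (R := ℂ) (((2 * t' : ℕ) : ℂ) * b ^ 2 / 2) * X ^ (2 * t')

lemma X_deriv_ff (t' : ℕ) (htp : 0 < t') (b : ℂ) :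
    X * derivative ℂ (ff t' b) = - (C (b * t') * X ^ t') - C ((2 * t' : ℂ) * b ^ 2 * t') * X ^ (2 * t') := by
  ext n
  rcases n with _ | n
  · simp [htp.ne']
  · rw [coeff_succ_X_mul, coeff_derivative]
    simp only [ff, map_sub, map_neg, coeff_C_mul, coeff_X_pow]
    by_cases h1 : n + 1 = t'
    · have h2 : n + 1 ≠ 2 * t' := by omega
      simp only [h1, h2, if_true, if_false]
      rw [if_neg (by omega), ← h1]; push_cast; ring
    · by_cases h2 : n + 1 = 2 * t'
      · simp only [h1, h2, if_true, if_false]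
        have : (n : ℂ) + 1 = 2 * t' := by exact_mod_cast h2
        rw [this, if_neg (by omega)]; push_cast; ring
      · simp [h1, h2]

lemma EE_rec (t' : ℕ) (htp : 0 < t') (b : ℂ) :
    X * derivative ℂ (EE t' b) = X * derivative ℂ (ff t' b) * EE t' b := by
  rw [X_deriv_ff t' htp]
  ext n
  have hl : coeff n (X * derivative ℂ (EE t' b)) = coeff n (EE t' b) * n := by
    rcases n with _ | n
    · simp
    · rw [coeff_succ_X_mul, coeff_derivative]; push_cast; rfl
  rw [hl, sub_mul, neg_mul, map_sub, map_neg, mul_assoc, mul_assoc, coeff_C_mul, coeff_C_mul,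
    coeff_X_pow_mul', coeff_X_pow_mul']
  simp only [EE, coeff_mk]
  by_cases hd : t' ∣ n
  · obtain ⟨w, rfl⟩ := hd
    rcases w with _ | _ | w
    · simp [htp.ne']
    · simp [ee, htp.ne', Nat.div_self htp]
      rw [if_neg (by omega)]; ring
    · have h1 : t' ≤ t' * (w + 1 + 1) := Nat.le_mul_of_pos_right _ (by omega)
      have h2 : 2 * t' ≤ t' * (w + 1 + 1) := by nlinarith
      have e1 : t' * (w + 1 + 1) - t' = t' * (w + 1) := by
        rw [Nat.sub_eq_iff_eq_add h1]; ring
      have e2 : t' * (w + 1 + 1) - 2 * t' = t' * w := by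
        rw [Nat.sub_eq_iff_eq_add h2]; ring
      rw [if_pos h1, if_pos h2, e1, e2]
      simp only [dvd_mul_right, if_true, Nat.mul_div_cancel_left _ htp]
      rw [ee]
      have : (w : ℂ) + 2 ≠ 0 := by exact_mod_cast (by omega : w + 2 ≠ 0)
      push_cast
      field_simp
      ring
  · rw [if_neg hd]
    have h1 : t' ≤ n → ¬ t' ∣ n - t' := fun h h' => hd ((Nat.dvd_sub_iff_left h dvd_rfl).1 h')
    have h2 : 2 * t' ≤ n → ¬ t' ∣ n - 2 * t' := fun h h' =>
      hd ((Nat.dvd_sub_iff_left h (dvd_mul_left _ _)).1 h')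
    by_cases a1 : t' ≤ n
    · by_cases a2 : 2 * t' ≤ n
      · simp [h1 a1, h2 a2]
      · simp [h1 a1, a2]
    · have a2 : ¬ 2 * t' ≤ n := by omega
      simp [a1, a2]

lemma EE_rec' (t' : ℕ) (htp : 0 < t') (b : ℂ) :
    derivative ℂ (EE t' b) = derivative ℂ (ff t' b) * EE t' b := by
  have h := EE_rec t' htp b
  rw [mul_assoc] at h
  exact mul_left_cancel₀ X_ne_zero h

def PK (f : PowerSeries ℂ) (K : ℕ) : PowerSeries ℂ :=
  ∑ k ∈ Finset.range K, C (R := ℂ) ((k.factorial : ℂ))⁻¹ * f ^ k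

lemma PK_deriv (f : PowerSeries ℂ) (K : ℕ) :
    derivative ℂ (PK f (K + 1)) = derivative ℂ f * PK f K := by
  induction K with
  | zero => simp [PK]
  | succ K ih =>
    have e : PK f (K + 1 + 1) = PK f (K + 1) + C (R := ℂ) (((K + 1).factorial : ℂ))⁻¹ * f ^ (K + 1) :=
      Finset.sum_range_succ _ _
    have e' : PK f (K + 1) = PK f K + C (R := ℂ) ((K.factorial : ℂ))⁻¹ * f ^ K :=
      Finset.sum_range_succ _ _
    rw [e, map_add, ih]
    rw [e']
    rw [mul_add]
    congr 1
    rw [Derivation.leibniz, Derivation.leibniz_pow, derivative_C]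
    have : C (R := ℂ) ((K.factorial : ℂ))⁻¹ = C (R := ℂ) (((K + 1).factorial : ℂ))⁻¹ * ((K + 1 : ℕ) : PowerSeries ℂ) := by
      have h3 : ((K + 1 : ℕ) : PowerSeries ℂ) = C (R := ℂ) ((K + 1 : ℕ) : ℂ) := by simp
      rw [h3, ← map_mul, Nat.factorial_succ]
      congr 1
      have : (K : ℂ) + 1 ≠ 0 := by exact_mod_cast Nat.succ_ne_zero K
      have : (K.factorial : ℂ) ≠ 0 := by exact_mod_cast Nat.factorial_ne_zero K
      push_cast
      field_simp
    rw [this]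
    simp [smul_eq_mul]
    ring

lemma PK_coeff (t' : ℕ) (htp : 0 < t') (b : ℂ) :
    ∀ n K, n < K → coeff n (PK (ff t' b) K) = coeff n (EE t' b) := by
  intro n
  induction n using Nat.strong_induction_on with
  | _ n ih =>
    intro K hK
    rcases n with _ | n
    · obtain ⟨K, rfl⟩ : ∃ L, K = L + 1 := ⟨K - 1, by omega⟩
      rw [PK, Finset.sum_range_succ', map_add, map_sum, Finset.sum_eq_zero]
      · simp [EE, ee]
      · intro k _
        simp [ff, htp.ne']
    · obtain ⟨K, rfl⟩ : ∃ L, K = L + 1 := ⟨K - 1, by omega⟩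
      have h : coeff n (derivative ℂ (PK (ff t' b) (K + 1))) = coeff n (derivative ℂ (EE t' b)) := by
        rw [PK_deriv, EE_rec' t' htp, coeff_mul, coeff_mul]
        refine Finset.sum_congr rfl fun p hp => ?_
        rw [Finset.HasAntidiagonal.mem_antidiagonal] at hp
        rw [ih p.2 (by omega) K (by omega)]
      rw [coeff_derivative, coeff_derivative] at h
      exact mul_right_cancel₀ (by exact_mod_cast Nat.succ_ne_zero n) h

theorem pexp_eq (t' : ℕ) (htp : 0 < t') (b : ℂ) : pexp (ff t' b) = EE t' b := by
  have := ps_t2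
  refine HasSum.tsum_eq ?_
  refine ps_tendsto _ _ _ fun n => ?_
  filter_upwards [Filter.eventually_ge_atTop (Finset.range (n + 1))] with s hs
  rw [← PK_coeff t' htp b n (n + 1) (by omega), PK]
  simp only [map_sum]
  refine (Finset.sum_subset hs fun k _ hk => ?_).symm
  rw [coeff_C_mul]
  have hX : (X : PowerSeries ℂ) ∣ ff t' b := by
    rw [X_dvd_iff]; simp [ff, htp.ne']
  have := X_pow_dvd_iff.1 (pow_dvd_pow_of_dvd hX k) n (by simpa using hk)
  rw [this, mul_zero]

def yy (μ : YoungDiagram) (i : ℕ) : ℤ := (μ.rowLen i : ℤ) - i - 1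
def zz (μ : YoungDiagram) (j : ℕ) : ℤ := (j : ℤ) - μ.colLen j

lemma cell_iff (μ : YoungDiagram) (i j : ℕ) : (i, j) ∈ μ ↔ zz μ j < yy μ i := by
  have h1 := μ.mem_iff_lt_rowLen (i := i) (j := j)
  have h2 := μ.mem_iff_lt_colLen (i := i) (j := j)
  unfold yy zz
  by_cases h : (i, j) ∈ μ
  · have a := h1.1 h; have b := h2.1 h
    simp only [h, true_iff]; omega
  · have a := mt h1.2 h
    have b := mt h2.2 h
    simp only [h, false_iff]; omega

lemma yz_ne (μ : YoungDiagram) (i j : ℕ) : yy μ i ≠ zz μ j := by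
  have h1 := μ.mem_iff_lt_rowLen (i := i) (j := j)
  have h2 := μ.mem_iff_lt_colLen (i := i) (j := j)
  unfold yy zz
  by_cases h : (i, j) ∈ μ
  · have a := h1.1 h; have b := h2.1 h; omega
  · have a := mt h1.2 h
    have b := mt h2.2 h; omega

lemma yy_anti (μ : YoungDiagram) : StrictAnti (yy μ) := by
  intro i j h
  have := μ.rowLen_anti i j h.le
  unfold yy; omega

lemma zz_mono (μ : YoungDiagram) : StrictMono (zz μ) := by
  intro i j h
  have := μ.colLen_anti i j h.le
  unfold zz; omega

lemma yz_cover (μ : YoungDiagram) (n : ℤ) (hn : n ∉ Set.range (yy μ)) : n ∈ Set.range (zz μ) := by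
  have hex : ∃ i, yy μ i ≤ n := by
    refine ⟨(μ.rowLen 0 + n.natAbs), ?_⟩
    have := μ.rowLen_anti 0 (μ.rowLen 0 + n.natAbs) (by omega)
    unfold yy; omega
  classical
  obtain ⟨h1, h2⟩ : yy μ (Nat.find hex) ≤ n ∧ ∀ k < Nat.find hex, ¬ yy μ k ≤ n :=
    ⟨Nat.find_spec hex, fun k hk => Nat.find_min hex hk⟩
  generalize Nat.find hex = i at h1 h2
  have h3 : yy μ i ≠ n := fun h => hn ⟨i, h⟩
  have h4 : yy μ i < n := lt_of_le_of_ne h1 h3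
  have h5 : 0 ≤ n + i := by unfold yy at h4; omega
  refine ⟨(n + i).toNat, ?_⟩
  have h6 : (i, (n + i).toNat) ∉ μ := by
    rw [μ.mem_iff_lt_rowLen]; unfold yy at h4; omega
  have h7 : μ.colLen (n + i).toNat ≤ i := by
    rw [μ.mem_iff_lt_colLen] at h6; omega
  have h8 : i ≤ μ.colLen (n + i).toNat := by
    rcases i with _ | i
    · omega
    · have := h2 i (by omega)
      have h9 : (i, (n + (i + 1 : ℕ)).toNat) ∈ μ := by
        rw [μ.mem_iff_lt_rowLen]; unfold yy at this; omega
      rw [μ.mem_iff_lt_colLen] at h9; omega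
  unfold zz; omega

def Aof (μ : YoungDiagram) : Finset ℕ :=
  (μ.cells.filter fun c => c.1 = c.2).image fun c => (yy μ c.1).toNat

lemma dd_z {μ : YoungDiagram} (h : DDiagram μ) {i : ℕ} (hi : (i, i) ∈ μ) :
    zz μ i = - yy μ i ∧ 1 ≤ yy μ i := by
  have h1 := h i hi
  have h2 := (cell_iff μ i i).1 hi
  unfold yy zz at *; omega

lemma nd_y {μ : YoungDiagram} {i : ℕ} (hi : (i, i) ∉ μ) : yy μ i ≤ -1 ∧ 0 ≤ zz μ i := by
  have h1 := mt μ.mem_iff_lt_rowLen.2 hi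
  have h2 := mt μ.mem_iff_lt_colLen.2 hi
  unfold yy zz; omega

lemma mem_Aof {μ : YoungDiagram} {a : ℕ} :
    a ∈ Aof μ ↔ ∃ i, (i, i) ∈ μ ∧ (yy μ i).toNat = a := by
  simp only [Aof, Finset.mem_image, Finset.mem_filter, YoungDiagram.mem_cells, Prod.exists]
  constructor
  · rintro ⟨i, j, ⟨h, rfl⟩, h2⟩; exact ⟨i, h, h2⟩
  · rintro ⟨i, h, h2⟩; exact ⟨i, i, ⟨h, rfl⟩, h2⟩

lemma Aof_zero {μ : YoungDiagram} (h : DDiagram μ) : 0 ∉ Aof μ := by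
  rw [mem_Aof]; rintro ⟨i, hi, h2⟩
  have := dd_z h hi; omega

lemma durfee_eq {μ : YoungDiagram} (h : DDiagram μ) : durfee μ = (Aof μ).card := by
  rw [durfee, Aof, Finset.card_image_of_injOn]
  rintro ⟨i, i'⟩ hi ⟨j, j'⟩ hj hij
  simp only [Finset.coe_filter, YoungDiagram.mem_cells, Set.mem_ofPred_eq] at hi hj
  obtain ⟨hi, rfl⟩ := hi
  obtain ⟨hj, rfl⟩ := hj
  have h1 := dd_z h hi
  have h2 := dd_z h hj
  have : yy μ i = yy μ j := by simp only at hij; omega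
  rw [(yy_anti μ).injective this]

lemma range_yy {μ : YoungDiagram} (h : DDiagram μ) : Set.range (yy μ) = XA (Aof μ) := by
  ext n
  rw [mem_XA]
  constructor
  · rintro ⟨i, rfl⟩
    by_cases hi : (i, i) ∈ μ
    · have := dd_z h hi
      left
      exact ⟨by omega, mem_Aof.2 ⟨i, hi, by omega⟩⟩
    · have := nd_y hi
      right
      refine ⟨by omega, fun hm => ?_⟩
      obtain ⟨j, hj, h2⟩ := mem_Aof.1 hm
      have h3 := dd_z h hj
      exact yz_ne μ i j (by omega)
  · rintro (⟨h1, h2⟩ | ⟨h1, h2⟩)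
    · obtain ⟨j, hj, h3⟩ := mem_Aof.1 h2
      have h4 := dd_z h hj
      exact ⟨j, by omega⟩
    · by_contra hc
      obtain ⟨j, rfl⟩ := yz_cover μ n hc
      by_cases hj : (j, j) ∈ μ
      · have := dd_z h hj
        exact h2 (mem_Aof.2 ⟨j, hj, by omega⟩)
      · have := nd_y hj; omega

lemma Aof_inj {μ ν : YoungDiagram} (h : DDiagram μ) (h' : DDiagram ν) (e : Aof μ = Aof ν) :
    μ = ν := by
  have h1 : Set.range (yy μ) = Set.range (yy ν) := by rw [range_yy h, range_yy h', e]
  have h2 : (fun i => - yy μ i) = fun i => - yy ν i := by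
    refine (StrictMono.range_inj (fun i j hij => neg_lt_neg (yy_anti μ hij))
      (fun i j hij => neg_lt_neg (yy_anti ν hij))).1 ?_
    have := congrArg (fun s => (fun x : ℤ => -x) '' s) h1
    simpa only [← Set.range_comp, Function.comp_def] using this
  have h3 : ∀ i, μ.rowLen i = ν.rowLen i := by
    intro i
    have := congrFun h2 i
    simp only [yy] at this; omega
  ext ⟨i, j⟩
  rw [YoungDiagram.mem_cells, YoungDiagram.mem_cells, μ.mem_iff_lt_rowLen, ν.mem_iff_lt_rowLen, h3]

lemma rowLen_eq_of {μ : YoungDiagram} {i n : ℕ} (h : ∀ j, (i, j) ∈ μ ↔ j < n) : μ.rowLen i = n := by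
  have h1 := h n; have h2 := h (μ.rowLen i)
  rw [μ.mem_iff_lt_rowLen] at h1 h2; omega

lemma colLen_eq_of {μ : YoungDiagram} {j n : ℕ} (h : ∀ i, (i, j) ∈ μ ↔ i < n) : μ.colLen j = n := by
  have h1 := h n; have h2 := h (μ.colLen j)
  rw [μ.mem_iff_lt_colLen] at h1 h2; omega

def shiftEmb : ℕ × ℕ ↪ ℕ × ℕ := ⟨fun c => (c.1 + 1, c.2 + 1), fun c d h => by
  simp only [Prod.mk.injEq] at h; ext <;> omega⟩

lemma shiftEmb_apply (c : ℕ × ℕ) : shiftEmb c = (c.1 + 1, c.2 + 1) := rfl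

lemma exists_add (μ : YoungDiagram) (h : DDiagram μ) (a : ℕ) (ha : ∀ x ∈ Aof μ, x < a) (h0 : 0 < a) :
    ∃ ν, DDiagram ν ∧ Aof ν = insert a (Aof μ) ∧ ν.card = μ.card + 2 * a := by
  have hb : μ.rowLen 0 ≤ a ∧ μ.colLen 0 + 1 ≤ a := by
    by_cases h00 : (0, 0) ∈ μ
    · have h1 := ha _ (mem_Aof.2 ⟨0, h00, rfl⟩)
      have h2 := h 0 h00
      unfold yy at h1; omega
    · have h1 := mt μ.mem_iff_lt_rowLen.2 h00
      have h2 := mt μ.mem_iff_lt_colLen.2 h00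
      omega
  have hcell : ∀ i j, (i, j) ∈ μ → i + 1 < a ∧ j < a := by
    intro i j hij
    have h1 := μ.mem_iff_lt_rowLen.1 hij
    have h2 := μ.mem_iff_lt_colLen.1 hij
    have h3 := μ.rowLen_anti 0 i (by omega)
    have h4 := μ.colLen_anti 0 j (by omega)
    omega
  set E : Finset (ℕ × ℕ) := (μ.cells.map shiftEmb) ∪
    ({0} ×ˢ Finset.range (a + 1) ∪ Finset.Ico 1 a ×ˢ {0}) with hE
  have hmem : ∀ i j, (i, j) ∈ E ↔ (i = 0 ∧ j < a + 1) ∨ (j = 0 ∧ i < a) ∨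
      (∃ i' j', i = i' + 1 ∧ j = j' + 1 ∧ (i', j') ∈ μ) := by
    intro i j
    simp only [hE, Finset.mem_union, Finset.mem_map, Finset.mem_product, Finset.mem_singleton,
      Finset.mem_range, Finset.mem_Ico, shiftEmb_apply, Prod.mk.injEq,
      Prod.exists, YoungDiagram.mem_cells]
    constructor
    · rintro (⟨i', j', h1, h2, h3⟩ | h1 | h1)
      · exact Or.inr (Or.inr ⟨i', j', h2.symm, h3.symm, h1⟩)
      · exact Or.inl h1
      · omega
    · rintro (h1 | h1 | ⟨i', j', h2, h3, h1⟩)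
      · exact Or.inr (Or.inl h1)
      · right; omega
      · exact Or.inl ⟨i', j', h1, h2.symm, h3.symm⟩
  have hlow : IsLowerSet (E : Set (ℕ × ℕ)) := by
    rintro ⟨i, j⟩ ⟨k, l⟩ hle hij
    rw [Finset.mem_coe, hmem] at hij ⊢
    obtain ⟨hk, hl⟩ := Prod.mk_le_mk.1 hle
    rcases hij with h1 | h1 | ⟨i', j', rfl, rfl, h1⟩
    · left; omega
    · right; left; omega
    · have := hcell _ _ h1
      rcases k with _ | k
      · left; omega
      · rcases l with _ | l
        · right; left; omega
        · right; right
          exact ⟨k, l, rfl, rfl, μ.isLowerSet (Prod.mk_le_mk.2 ⟨by omega, by omega⟩) h1⟩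
  set ν : YoungDiagram := ⟨E, hlow⟩ with hν
  have hm : ∀ i j, (i, j) ∈ ν ↔ (i = 0 ∧ j < a + 1) ∨ (j = 0 ∧ i < a) ∨
      (∃ i' j', i = i' + 1 ∧ j = j' + 1 ∧ (i', j') ∈ μ) := hmem
  have hr0 : ν.rowLen 0 = a + 1 := rowLen_eq_of fun j => by
    rw [hm]; constructor
    · rintro (h1 | h1 | ⟨i', j', h1, -⟩) <;> omega
    · intro h1; left; omega
  have hc0 : ν.colLen 0 = a := colLen_eq_of fun j => by
    rw [hm]; constructor
    · rintro (h1 | h1 | ⟨i', j', -, h1, -⟩) <;> omega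
    · intro h1; right; left; omega
  have hd : ∀ i j, (i + 1, j + 1) ∈ ν ↔ (i, j) ∈ μ := by
    intro i j
    rw [hm]; constructor
    · rintro (h1 | h1 | ⟨i', j', h1, h2, h3⟩)
      · omega
      · omega
      · rwa [Nat.succ_injective h1, Nat.succ_injective h2]
    · intro h1; right; right; exact ⟨i, j, rfl, rfl, h1⟩
  have hrS : ∀ i, (i, i) ∈ μ → ν.rowLen (i + 1) = μ.rowLen i + 1 := by
    intro i hi
    have := hcell _ _ hi
    refine rowLen_eq_of fun j => ?_
    rcases j with _ | j
    · rw [hm]; simp; omega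
    · rw [hd, μ.mem_iff_lt_rowLen]; omega
  have hcS : ∀ i, (i, i) ∈ μ → ν.colLen (i + 1) = μ.colLen i + 1 := by
    intro i hi
    have := hcell _ _ hi
    refine colLen_eq_of fun j => ?_
    rcases j with _ | j
    · rw [hm]; simp; omega
    · rw [hd, μ.mem_iff_lt_colLen]; omega
  refine ⟨ν, ?_, ?_, ?_⟩
  · intro i hi
    rcases i with _ | i
    · rw [hr0, hc0]
    · rw [hd] at hi
      rw [hrS i hi, hcS i hi, h i hi]
  · ext x
    rw [Finset.mem_insert, mem_Aof, mem_Aof]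
    constructor
    · rintro ⟨i, hi, rfl⟩
      rcases i with _ | i
      · left; unfold yy; omega
      · rw [hd] at hi
        right; refine ⟨i, hi, ?_⟩
        unfold yy; rw [hrS i hi]; push_cast; omega
    · rintro (rfl | ⟨i, hi, rfl⟩)
      · refine ⟨0, ?_, ?_⟩
        · rw [hm]; left; omega
        · unfold yy; omega
      · refine ⟨i + 1, (hd i i).2 hi, ?_⟩
        unfold yy; rw [hrS i hi]; push_cast; omega
  · show E.card = μ.cells.card + 2 * a
    rw [hE, Finset.card_union_of_disjoint, Finset.card_union_of_disjoint]
    · simp; omega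
    · rw [Finset.disjoint_left]
      rintro ⟨i, j⟩ h1 h2
      simp only [Finset.mem_product, Finset.mem_singleton, Finset.mem_Ico] at h1 h2
      omega
    · rw [Finset.disjoint_left]
      rintro ⟨i, j⟩ h1 h2
      simp only [Finset.mem_product, Finset.mem_singleton, Finset.mem_Ico, Finset.mem_union,
        Finset.mem_map, shiftEmb_apply, Prod.mk.injEq] at h1 h2
      obtain ⟨c, -, h3, h4⟩ := h1
      omega

lemma Aof_surj (A : Finset ℕ) : 0 ∉ A →
    ∃ ν, DDiagram ν ∧ Aof ν = A ∧ ν.card = 2 * ∑ a ∈ A, a := by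
  induction A using Finset.induction_on_max with
  | empty =>
    intro _
    have hn : ∀ c : ℕ × ℕ, c ∉ (⊥ : YoungDiagram) := fun c => YoungDiagram.notMem_bot c
    refine ⟨⊥, fun i hi => absurd hi (hn _), ?_, by simp⟩
    ext x
    rw [mem_Aof]
    simp [hn]
  | insert a A hA ih =>
    intro h0
    obtain ⟨μ, h1, h2, h3⟩ := ih (fun h => h0 (Finset.mem_insert_of_mem h))
    have ha : 0 < a := Nat.pos_of_ne_zero fun h => h0 (by simp [h])
    obtain ⟨ν, h4, h5, h6⟩ := exists_add μ h1 a (by rw [h2]; exact hA) ha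
    refine ⟨ν, h4, by rw [h5, h2], ?_⟩
    rw [Finset.sum_insert (fun h => (hA a h).ne rfl), h6, h3]; ring

lemma card_eq {μ : YoungDiagram} (h : DDiagram μ) : μ.card = 2 * ∑ a ∈ Aof μ, a := by
  obtain ⟨ν, h1, h2, h3⟩ := Aof_surj (Aof μ) (Aof_zero h)
  rw [← Aof_inj h1 h h2, h3, ← h2]

def ddEquiv : {μ : YoungDiagram // DDiagram μ} ≃ {A : Finset ℕ // 0 ∉ A} :=
  Equiv.ofBijective (fun μ => ⟨Aof μ.1, Aof_zero μ.2⟩) ⟨by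
    intro μ ν h
    exact Subtype.ext (Aof_inj μ.2 ν.2 (Subtype.ext_iff.1 h)), by
    rintro ⟨A, hA⟩
    obtain ⟨ν, h1, h2, -⟩ := Aof_surj A hA
    exact ⟨⟨ν, h1⟩, Subtype.ext h2⟩⟩

lemma hookLen_cast {μ : YoungDiagram} {i j : ℕ} (h : (i, j) ∈ μ) :
    (hookLen μ (i, j) : ℤ) = yy μ i - zz μ j := by
  have h1 := μ.mem_iff_lt_rowLen.1 h
  have h2 := μ.mem_iff_lt_colLen.1 h
  simp only [hookLen, yy, zz]; omega

lemma eps_iff {μ : YoungDiagram} (hd : DDiagram μ) {i j : ℕ} (h : (i, j) ∈ μ) :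
    j < i ↔ yy μ i + zz μ j < 0 := by
  constructor
  · intro hij
    have h1 : (j, j) ∈ μ := μ.isLowerSet (Prod.mk_le_mk.2 ⟨hij.le, le_rfl⟩) h
    have h2 := dd_z hd h1
    have h3 := yy_anti μ hij
    omega
  · intro hs
    by_contra hij
    push Not at hij
    have h1 : (i, i) ∈ μ := μ.isLowerSet (Prod.mk_le_mk.2 ⟨le_rfl, hij⟩) h
    have h2 := dd_z hd h1
    have h3 := (zz_mono μ).monotone hij
    omega

lemma not_mem_XA_iff {μ : YoungDiagram} (hd : DDiagram μ) (n : ℤ) :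
    n ∉ XA (Aof μ) ↔ n ∈ Set.range (zz μ) := by
  rw [← range_yy hd]
  constructor
  · exact yz_cover μ n
  · rintro ⟨j, rfl⟩ ⟨i, hi⟩
    exact yz_ne μ i j hi

lemma prod_cells (t : ℕ) (b : ℂ) {μ : YoungDiagram} (hd : DDiagram μ) :
    ∏ c ∈ μ.cells.filter (fun c => t ∣ hookLen μ c),
          (b * (t : ℕ) / ((hookLen μ c : ℂ) * eps c)) =
      b ^ wt t (Aof μ) * (-1) ^ Nn t (Aof μ) * Gh t (XA (Aof μ)) := by
  classical
  have hfin := hooks_finite t (XA_maya' (Aof μ))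
  have h1 : ∏ c ∈ μ.cells.filter (fun c => t ∣ hookLen μ c),
          (b * (t : ℕ) / ((hookLen μ c : ℂ) * eps c)) =
      ∏ p ∈ hfin.toFinset, (b * (if p.1 + p.2 < 0 then -1 else 1) * ((t : ℂ) / ((p.1 : ℂ) - p.2))) := by
    refine Finset.prod_bij (fun c _ => (yy μ c.1, zz μ c.2)) ?_ ?_ ?_ ?_
    · rintro ⟨i, j⟩ hc
      rw [Finset.mem_filter, YoungDiagram.mem_cells] at hc
      rw [Set.Finite.mem_toFinset]
      refine ⟨?_, ?_, (cell_iff μ i j).1 hc.1, ?_⟩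
      · rw [← range_yy hd]; exact ⟨i, rfl⟩
      · rw [not_mem_XA_iff hd]; exact ⟨j, rfl⟩
      · have h2 : (t : ℤ) ∣ (hookLen μ (i, j) : ℤ) := Int.natCast_dvd_natCast.2 hc.2
        rw [hookLen_cast hc.1] at h2
        exact (Int.emod_emod_of_dvd _ dvd_rfl).symm.trans
          (by rw [Int.emod_eq_emod_iff_emod_sub_eq_zero.2 (Int.emod_eq_zero_of_dvd h2)]; simp)
    · rintro ⟨i, j⟩ _ ⟨k, l⟩ _ h
      simp only [Prod.mk.injEq] at h
      rw [(yy_anti μ).injective h.1, (zz_mono μ).injective h.2]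
    · rintro ⟨p, q⟩ hp
      rw [Set.Finite.mem_toFinset] at hp
      obtain ⟨hp1, hp2, hp3, hp4⟩ := hp
      simp only at hp1 hp2 hp3 hp4
      rw [← range_yy hd] at hp1
      rw [not_mem_XA_iff hd] at hp2
      obtain ⟨i, rfl⟩ := hp1
      obtain ⟨j, rfl⟩ := hp2
      have hc := (cell_iff μ i j).2 hp3
      refine ⟨(i, j), ?_, rfl⟩
      rw [Finset.mem_filter, YoungDiagram.mem_cells]
      refine ⟨hc, ?_⟩
      rw [← Int.natCast_dvd_natCast, hookLen_cast hc]
      exact Int.dvd_of_emod_eq_zero (Int.emod_eq_emod_iff_emod_sub_eq_zero.1 hp4)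
    · rintro ⟨i, j⟩ hc
      rw [Finset.mem_filter, YoungDiagram.mem_cells] at hc
      have h2 : (hookLen μ (i, j) : ℂ) = (yy μ i : ℂ) - zz μ j := by
        exact_mod_cast congrArg (fun z : ℤ => (z : ℂ)) (hookLen_cast hc.1)
      rw [h2]
      have h3 := eps_iff hd hc.1
      simp only [eps]
      by_cases h : j < i
      · rw [if_pos h, if_pos (h3.1 h)]; rw [mul_neg_one, div_neg]; ring
      · rw [if_neg h, if_neg (fun x => h (h3.2 x))]; ring
  rw [h1, Finset.prod_mul_distrib, Finset.prod_mul_distrib, Finset.prod_const, Gh,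
    finprod_mem_eq_finite_toFinset_prod _ hfin, wt, Set.ncard_eq_toFinset_card _ hfin]
  congr 2
  rw [Finset.prod_ite, Finset.prod_const, Finset.prod_const_one, mul_one, Nn]
  congr 1
  rw [← Set.ncard_coe_finset]
  congr 1
  ext p
  simp

def Tm (t : ℕ) (b : ℂ) (A : Finset ℕ) : ℂ := Sg t A * b ^ wt t A * Gh t (XA A)

lemma term_eq (t : ℕ) (b : ℂ) {μ : YoungDiagram} (hd : DDiagram μ) :
    PowerSeries.C (R := ℂ) ((-1) ^ durfee μ *
        ∏ c ∈ μ.cells.filter (fun c => t ∣ hookLen μ c),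
          (b * (t : ℕ) / ((hookLen μ c : ℂ) * eps c))) * X ^ (μ.card / 2) =
    C (R := ℂ) (Tm t b (Aof μ)) * X ^ (∑ a ∈ Aof μ, a) := by
  rw [prod_cells t b hd, durfee_eq hd, card_eq hd, Nat.mul_div_cancel_left _ (by omega)]
  congr 2
  rw [Tm, Sg, pow_add]; ring

/-- finite sets of positive integers with sum `n` -/
def SA (n : ℕ) : Finset (Finset ℕ) :=
  ((Finset.range (n + 1)).powerset).filter fun A => 0 ∉ A ∧ ∑ a ∈ A, a = n

lemma mem_SA {n : ℕ} {A : Finset ℕ} : A ∈ SA n ↔ 0 ∉ A ∧ ∑ a ∈ A, a = n := by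
  rw [SA, Finset.mem_filter, Finset.mem_powerset, and_iff_right_iff_imp]
  rintro ⟨-, h⟩ a ha
  have := Finset.single_le_sum (f := fun a : ℕ => a) (fun _ _ => Nat.zero_le _) ha
  rw [Finset.mem_range]; omega

lemma sum_SA (t' : ℕ) (htp : 0 < t') (b : ℂ) (n : ℕ) :
    ∑ A ∈ SA n, Tm (2 * t') b A =
      coeff n (EE t' b * PowerSeries.mk (fun n => aa (2 * t') n 0)) := by
  classical
  obtain ⟨W, hW⟩ : ∃ W : ℕ, n < W ∧ ∀ A ∈ SA n, wt (2 * t') A < W := by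
    refine ⟨(SA n).sup (wt (2 * t')) + n + 1, by omega, fun A hA => ?_⟩
    have := Finset.le_sup (f := wt (2 * t')) hA
    omega
  have h1 : ∑ A ∈ SA n, Tm (2 * t') b A =
      ∑ w ∈ Finset.range W, b ^ w * aa (2 * t') n w := by
    rw [← Finset.sum_fiberwise_of_maps_to (s := SA n) (t := Finset.range W) (g := wt (2 * t'))
      (fun A hA => Finset.mem_range.2 (hW.2 A hA))]
    refine Finset.sum_congr rfl fun w _ => ?_
    have : (SA n).filter (fun A => wt (2 * t') A = w) = AA (2 * t') n w := by
      ext A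
      rw [Finset.mem_filter, mem_SA, mem_AA, ← Nat.cast_sum, Nat.cast_inj, Nat.cast_inj, and_assoc]
    rw [this, aa, Finset.mul_sum]
    refine Finset.sum_congr rfl fun A hA => ?_
    have := (mem_AA.1 hA).2.2
    rw [Tm, Nat.cast_inj.1 this]; ring
  rw [h1, coeff_mul, Finset.Nat.sum_antidiagonal_eq_sum_range_succ_mk]
  simp only [EE, coeff_mk, ite_mul, zero_mul]
  rw [← Finset.sum_filter]
  have h2 : ∑ w ∈ Finset.range W, b ^ w * aa (2 * t') n w =
      ∑ w ∈ (Finset.range W).filter (fun w => t' * w ≤ n), b ^ w * aa (2 * t') n w := by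
    rw [Finset.sum_filter]
    refine Finset.sum_congr rfl fun w _ => ?_
    split_ifs with h
    · rfl
    · rw [aa_eq t' htp, aa_neg' _ _ _ (by push Not at h; have : (n : ℤ) < t' * w := by exact_mod_cast h
                                          omega)]
      simp
  rw [h2]
  symm
  refine Finset.sum_nbij' (fun k => k / t') (fun w => t' * w) ?_ ?_ ?_ ?_ ?_
  · intro k hk
    rw [Finset.mem_filter, Finset.mem_range] at hk ⊢
    rw [Nat.mul_div_cancel' hk.2]
    have := Nat.div_le_self k t'
    omega
  · intro w hw
    rw [Finset.mem_filter, Finset.mem_range] at hw ⊢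
    exact ⟨by omega, dvd_mul_right _ _⟩
  · intro k hk
    rw [Finset.mem_filter] at hk
    exact Nat.mul_div_cancel' hk.2
  · intro w hw
    exact Nat.mul_div_cancel_left _ htp
  · intro k hk
    rw [Finset.mem_filter, Finset.mem_range] at hk
    obtain ⟨hk, w, rfl⟩ := hk
    rw [Nat.mul_div_cancel_left _ htp, aa_eq t' htp, Nat.cast_sub (by omega)]
    push_cast
    ring

theorem exp_genfun_DD_even (t' : ℕ) (ht' : 0 < t') (b : ℂ) :
    ∑' μ : {μ : YoungDiagram // DDiagram μ},
      PowerSeries.C (R := ℂ) ((-1) ^ durfee μ.1 *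
        ∏ c ∈ μ.1.cells.filter (fun c => (2 * t') ∣ hookLen μ.1 c),
          (b * (2 * t' : ℕ) / ((hookLen μ.1 c : ℂ) * eps c))) * X ^ (μ.1.card / 2)
      =
    pexp (- (PowerSeries.C (R := ℂ) b * X ^ t') -
        PowerSeries.C (R := ℂ) (((2 * t' : ℕ) : ℂ) * b ^ 2 / 2) * X ^ (2 * t')) *
      ∏' k : ℕ,
        ((1 - X ^ (k + 1)) * (1 - X ^ ((k + 1) * (2 * t'))) ^ (t' - 1) *
          (1 - X ^ ((k + 1) * t') : PowerSeries ℂ)⁻¹) := by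
  have := ps_t2
  have hF := FF_tprod t' ht'
  unfold FF at hF
  have hE := pexp_eq t' ht' b
  unfold ff at hE
  rw [hF, hE]
  refine HasSum.tsum_eq ?_
  have h1 : HasSum (fun A : {A : Finset ℕ // 0 ∉ A} =>
      C (R := ℂ) (Tm (2 * t') b A.1) * X ^ (∑ a ∈ A.1, a))
      (EE t' b * PowerSeries.mk (fun n => aa (2 * t') n 0)) := by
    refine ps_tendsto _ _ _ fun n => ?_
    classical
    filter_upwards [Filter.eventually_ge_atTop ((SA n).subtype (fun A => 0 ∉ A))] with s hs
    rw [← sum_SA t' ht' b n, map_sum]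
    rw [← Finset.sum_subset hs]
    · have hg : ∑ A ∈ SA n, Tm (2 * t') b A = ∑ A ∈ (SA n).filter (fun A => 0 ∉ A), Tm (2 * t') b A := by
        rw [Finset.filter_true_of_mem]
        exact fun A hA => (mem_SA.1 hA).1
      rw [hg, ← Finset.sum_subtype_eq_sum_filter]
      refine Finset.sum_congr rfl fun A hA => ?_
      rw [Finset.mem_subtype, mem_SA] at hA
      rw [coeff_C_mul, coeff_X_pow, if_pos hA.2.symm, mul_one]
    · intro A _ hA
      rw [Finset.mem_subtype, mem_SA] at hA
      rw [coeff_C_mul, coeff_X_pow, if_neg (fun h => hA ⟨A.2, h.symm⟩), mul_zero]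
  have h2 := (ddEquiv.hasSum_iff).2 h1
  convert h2 using 1
  funext μ
  exact term_eq (2 * t') b μ.2
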